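/- arXiv:1706.08134 — 3 statements merged into one kernel-verified Lean document; each statement's English description precedes it below -/
import Mathlib

section
/- The restricted size Ramsey number r*(P_3, C_11) equals 20: there exists a simple graph F on 11 vertices with 20 edges such that F → (P_3, C_11), and every simple graph on 11 vertices with fewer than 20 edges fails to arrow (P_3, C_11). -/
open SimpleGraph

/-- `F` contains a copy of `G` (an injective graph homomorphism from `G` to `F`). -/
def Contains {α β : Type*} (F : SimpleGraph α) (G : SimpleGraph β) : Prop :=
  ∃ f : G →g F, Function.Injective f

/-- `F → (G, H)`: for every red/blue coloring of the edges of `F` (given by the spanning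
subgraph `R ≤ F` of red edges, the other edges of `F` being blue), there is a red copy of `G`
or a blue copy of `H`. -/
def Arrows {α β γ : Type*} (F : SimpleGraph α) (G : SimpleGraph β) (H : SimpleGraph γ) : Prop :=
  ∀ R : SimpleGraph α, R ≤ F → Contains R G ∨ Contains (F \ R) H


namespace RSR

/-! ### The computable checker -/

/-- Membership test for lists of natural numbers. -/
def mem' (x : ℕ) : List ℕ → Bool
  | [] => false
  | y :: l => Nat.beq x y || mem' x l

/-- Insertion without repetition. -/
def ins (x : ℕ) (l : List ℕ) : List ℕ := bif mem' x l then l else x :: l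

/-- Neighbours of `v` in a list of edges, without repetition. -/
def nb (v : ℕ) : List (ℕ × ℕ) → List ℕ
  | [] => []
  | (a, b) :: l =>
    bif Nat.beq a v then ins b (nb v l) else bif Nat.beq b v then ins a (nb v l) else nb v l

/-- Lookup of the degree of a labelled vertex; `0` means unknown. -/
def dg : List (ℕ × ℕ) → ℕ → ℕ
  | [], _ => 0
  | (a, d) :: l, i => bif Nat.beq a i then d else dg l i

/-- A state of the search: `k` labelled vertices, their degrees, known edges, known non-edges,
and the list `sd` of labelled vertices all of whose neighbours of degree 3 are known. -/
structure St where
  k : ℕ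
  deg : List (ℕ × ℕ)
  yes : List (ℕ × ℕ)
  no : List (ℕ × ℕ)
  sd : List ℕ

def filt (p : ℕ → Bool) : List ℕ → List ℕ
  | [] => []
  | x :: l => bif p x then x :: filt p l else filt p l

def len : List ℕ → ℕ
  | [] => 0
  | _ :: l => Nat.succ (len l)

def all' (p : ℕ → Bool) : List ℕ → Bool
  | [] => true
  | x :: l => p x && all' p l

def allLt (p : ℕ → Bool) : ℕ → Bool
  | 0 => true
  | k + 1 => p k && allLt p k

def cntLt (p : ℕ → Bool) : ℕ → ℕ
  | 0 => 0
  | k + 1 => bif p k then Nat.succ (cntLt p k) else cntLt p k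

def sumLt (g : ℕ → ℕ) : ℕ → ℕ
  | 0 => 0
  | k + 1 => Nat.add (g k) (sumLt g k)

/-- All neighbours of the labelled vertex `v` are known. -/
def closed (st : St) (v : ℕ) : Bool :=
  Nat.blt 0 (dg st.deg v) && Nat.ble (dg st.deg v) (len (nb v st.yes))

def under (st : St) (v : ℕ) (hout : List (ℕ × ℕ)) : Bool :=
  closed st v && Nat.ble (len (filt (fun j => !mem' j (nb v hout)) (nb v st.yes))) 1

/-- Follow a path of edges of the Hamiltonian cycle until it returns to `a`. -/
def walk (hin : List (ℕ × ℕ)) (a : ℕ) : ℕ → ℕ → ℕ → List ℕ → List ℕ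
  | 0, _, _, _ => []
  | n + 1, p, c, acc =>
    match filt (fun j => !Nat.beq j p) (nb c hin) with
    | [] => []
    | x :: _ => bif Nat.beq x a then c :: acc else walk hin a n c x (c :: acc)

def isCyc (hin : List (ℕ × ℕ)) (X : List ℕ) : Bool :=
  match X with
  | [] => false
  | x :: l => Nat.ble (len (x :: l)) 10 &&
      all' (fun y => Nat.ble 2 (len (filt (fun j => mem' j (x :: l)) (nb y hin)))) (x :: l)

def badIn (a b : ℕ) (hin : List (ℕ × ℕ)) : Bool :=
  Nat.ble 3 (len (nb a hin)) || Nat.ble 3 (len (nb b hin)) || isCyc hin (walk hin a 11 a b [a])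

def badOut (st : St) (a b : ℕ) (hout : List (ℕ × ℕ)) : Bool :=
  under st a hout || under st b hout

/-- Unit propagation along a prescribed list of edges. -/
def refute (st : St) : List (ℕ × ℕ) → List (ℕ × ℕ) → List (ℕ × ℕ) → Bool
  | [], _, _ => false
  | (a, b) :: es, hin, hout =>
    Nat.blt a st.k && Nat.blt b st.k &&
    (bif badIn a b ((a, b) :: hin) then
      (bif badOut st a b ((a, b) :: hout) then true else refute st es hin ((a, b) :: hout))
    else
      (bif badOut st a b ((a, b) :: hout) then refute st es ((a, b) :: hin) hout
       else refute st es hin hout))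

/-- `M` is a matching consisting of known edges (`used` are the forbidden vertices). -/
def isM (st : St) : List (ℕ × ℕ) → List ℕ → Bool
  | [], _ => true
  | (a, b) :: l, used => mem' b (nb a st.yes) && !mem' a used && !mem' b used &&
      isM st l (a :: b :: used)

def isNo (st : St) (i j : ℕ) : Bool :=
  mem' j (nb i st.no) || closed st i || closed st j

/-- Parameters of the search. -/
structure Par where
  lem : Bool
  n : ℕ → ℕ
  slack : ℕ

/-- Evaluate a digit before passing it on. -/
def force {α : Type} (x : ℕ) (g : ℕ → α) : α :=
  bif Nat.beq x 0 then g 0 else bif Nat.beq x 1 then g 1 else bif Nat.beq x 2 then g 2 else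
  bif Nat.beq x 3 then g 3 else bif Nat.beq x 4 then g 4 else bif Nat.beq x 5 then g 5 else
  bif Nat.beq x 6 then g 6 else bif Nat.beq x 7 then g 7 else bif Nat.beq x 8 then g 8 else
  bif Nat.beq x 9 then g 9 else bif Nat.beq x 10 then g 10 else g x

/-- Read `n` edges from the stream. -/
def takeE {α : Type} : ℕ → List ℕ → List (ℕ × ℕ) → (List (ℕ × ℕ) → List ℕ → Option α) → Option α
  | 0, s, acc, g => g acc s
  | _ + 1, [], _, _ => none
  | n + 1, a :: s, acc, g =>
    match s with
    | [] => none
    | b :: s => force a fun a => force b fun b => takeE n s ((a, b) :: acc) g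

/-- Labelled neighbours of degree 3. -/
def nbS (st : St) (i : ℕ) : List ℕ := filt (fun j => Nat.beq (dg st.deg j) 3) (nb i st.yes)

def addYes (st : St) (i j : ℕ) : St := ⟨st.k, st.deg, (i, j) :: st.yes, st.no, st.sd⟩
def addNo (st : St) (i j : ℕ) : St := ⟨st.k, st.deg, st.yes, (i, j) :: st.no, st.sd⟩
def addSd (st : St) (i : ℕ) : St := ⟨st.k, st.deg, st.yes, st.no, i :: st.sd⟩

def pairs (k : ℕ) (no : List (ℕ × ℕ)) : List ℕ → List (ℕ × ℕ)
  | [] => no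
  | i :: l => (i, k) :: pairs k no l

/-- Add a new vertex of degree 3 (not adjacent to the vertices in `sd`). -/
def addS (st : St) : St :=
  ⟨Nat.succ st.k, (st.k, 3) :: st.deg, st.yes, pairs st.k st.no st.sd, st.sd⟩
def addB (st : St) (d : ℕ) : St :=
  ⟨Nat.succ st.k, (st.k, d) :: st.deg, st.yes, st.no, st.sd⟩

def canFresh (st : St) (i : ℕ) : Bool :=
  Nat.blt i st.k && Nat.blt (len (nb i st.yes)) (dg st.deg i) &&
    allLt (fun j => Nat.beq j i || mem' j (nb i st.yes) || isNo st i j) st.k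

def canFreshS (st : St) (i : ℕ) : Bool :=
  Nat.blt i st.k &&
    allLt (fun j => Nat.beq j i || mem' j (nb i st.yes) || isNo st i j ||
      (!Nat.beq (dg st.deg j) 3 && !Nat.beq (dg st.deg j) 0)) st.k

def prune (P : Par) (st : St) (i : ℕ) : Bool :=
  Nat.blt i st.k &&
  ((Nat.blt 0 (dg st.deg i) && Nat.blt (dg st.deg i) (len (nb i st.yes))) ||
   (P.lem && Nat.ble 3 (len (nbS st i))))

def deficit (st : St) : ℕ :=
  sumLt (fun i => bif Nat.beq (dg st.deg i) 3 && mem' i st.sd then Nat.sub 2 (len (nbS st i))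
    else 0) st.k

/-- The certificate checker. -/
def check (P : Par) : ℕ → St → List ℕ → Option (List ℕ)
  | 0, _, _ => none
  | _ + 1, _, [] => none
  | n + 1, st, t :: s =>
    bif Nat.beq t 0 then
      (match s with
      | [] => none
      | m :: s =>
        takeE m s [] fun M s =>
          match s with
          | [] => none
          | m :: s =>
            takeE m s [] fun o s => bif isM st M [] && refute st o [] M then some s else none)
    else bif Nat.beq t 3 then
      (bif P.lem && Nat.blt (cntLt (fun i => Nat.beq (dg st.deg i) 3) st.k) (P.n 3) &&
          allLt (fun i => Nat.blt 0 (dg st.deg i)) st.k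
        then check P n (addS st) s else none)
    else bif Nat.beq t 7 then
      (bif P.lem && Nat.blt P.slack (deficit st) &&
          allLt (fun i => Nat.blt 0 (dg st.deg i)) st.k then some s else none)
    else
      match s with
      | [] => none
      | i :: s =>
        force i fun i =>
        bif Nat.beq t 1 then
          (match s with
          | [] => none
          | j :: s =>
            force j fun j =>
            bif Nat.blt i st.k && Nat.blt j st.k then
              (match check P n (addYes st i j) s with
              | none => none
              | some s => check P n (addNo st i j) s)
            else none)
        else bif Nat.beq t 2 then
          (bif P.lem && canFreshS st i then
            (match check P n (addYes (addS st) i st.k) s with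
            | none => none
            | some s => check P n (addSd st i) s)
          else none)
        else bif Nat.beq t 4 then
          (bif P.lem && canFresh st i then
            (match (bif mem' i st.sd then some s else check P n (addYes (addS st) i st.k) s) with
            | none => none
            | some s =>
              match check P n (addYes (addB st 4) i st.k) s with
              | none => none
              | some s => check P n (addYes (addB st 5) i st.k) s)
          else none)
        else bif Nat.beq t 5 then
          (bif prune P st i then some s else none)
        else bif Nat.beq t 6 then
          (bif P.lem && Nat.blt (P.n i) (cntLt (fun j => Nat.beq (dg st.deg j) i) st.k) &&
            Nat.blt 0 i then some s else none)
        else bif Nat.beq t 8 then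
          (bif !P.lem && canFresh st i then
            check P n (addYes (addB st 0) i st.k) s
          else none)
        else none

/-- Decode the certificate. -/
def dig : ℕ → ℕ → List ℕ → List ℕ
  | 0, _, r => r
  | n + 1, c, r => (c % 16) :: dig n (c / 16) r

def digs : List ℕ → List ℕ
  | [] => []
  | c :: cs => dig 64 c (digs cs)

/-! ### Certificates -/

def certL : List ℕ := [
  58805985174884176135177160855333737789109852192387600706054608213693772665361,
  29517410354128646468134364946620038329469560577011279351409959852260652560913,
  9132860686620068367731194535096244642136985876896756831538958684788308324385,
  29575480886290508622796726669400018334295489196181911156114622823932798042882,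
  37292958465938532297670649716517326005151487954366452509759768152370324783632,
  8709362898705651775407702775795180353755994076410165952438854304285381042242,
  22220201756917626106243707089095746896775069877722427456966283249593170854659,
  2348361907714206334462392274661263109196223212316486824612512938802547990789,
  44810796046754642388850552275910256538553267899810232338324595154527943082785,
  1586656839542117322878126121571755871485309831408629744907905125939164754448,
  909948704672853306755295871949122668295943714859444943349385242939912947250,
  23694213708130483342707534004627654775030863937064727382954552648340091376257,
  23637674602091643339872028513415780414270054618916879964855404447519356421156,
  22626582566720028527934226546655931203627740181483875252076112938606331627046,
  25358350336223996834244677103025831229047167409090759269033508767071486559524,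
  37577642641894662962680132018166609269484049273213021384567014157088530264864,
  29519190784056173187663143086976201997976992055554155295231130070719655990064,
  10037569905589539316995353029162647689207033744167578938198819563499282305072,
  44558448926138463936598810911961892366676119374616072034817711004818680787059,
  115792089237316195423570985008687907853269984665640564039457584007848738882369]

def cert6 : List ℕ := [
  14643858852473234115784083499786583539151128816313850908171830132560409788930,
  16007892505138054830044152738793887130330633601196538553614837839265292948566,
  14533100087630598415450980423363216876537935974870532043177018170021214438245,
  14962255367571187534023589656264064496412302213095983640680198418953641403408,
  9980948140413174055520312372073852065447412265664729690782800737315395338502,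
  3198008743349587022945501332756177827018120907200640831581681023341750936930,
  44443278134425177767551056843059941486355508163909215343632612806959382405430,
  16795993751963688356083074650922181388184989985377536773875058518017887461409,
  14644306165392555002233060713886457740143791875322682264841812435722418992434,
  14560933664853703594138088646319382495311163575428156981281071468992601986849,
  14983528324206355484297170179689794597258020647818208185808367518346860975632,
  7293884224460596993637788471817679328701683274319051490674228185920322954007,
  29909863949336030038403428318487561663013590700094169433617362548938360903254,
  8634741722407831438656891086890360917766519967659303552214639633963965358864,
  30483656669661650553633999623116550632166046385879140445736800882293996593283,
  16311756016424310620684303290256488974069268642489180571902359464737180311824,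
  29863699106012260279459575233800205965806691897611556597475846730995238831665,
  38256235606370170985370872467400284175035966288807070718645050423430388924677,
  22621067263119082539118923218748526299979690204743699992064419266945226134419,
  7406963757109448411743286942367432929540476697032997419094387847848596103265,
  59737140782504908696024471969324873635089450107841466256961407623840060802865,
  52525741199209088381422648439945763859854962057599469829948770464938004070944,
  66999862808775082013946240393987720425483016407871995058970711951343723496224,
  39051338788449139252686779397529541835662064079702894922738314427553326580512,
  8152274712675878919842037307702159776248288871476013796441920369806535972438,
  14733959932711839053358549777669505452757655573694578577422380692886457032818,
  18186821200270419144035500537099705329745092425282677509366291226603250980404,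
  30362080584471399228666126624603522601646975339200192901763688550955642651416,
  45862749043386186454114188773049580742747439215827475663725869585840731334696,
  22280165418070543117855005969211665066671899907171932967301101073442681480549,
  2719330876461306942168910874984935091757075902728474340910586293190702602020,
  43877901363218606110255131002116021724346636866931937638215017572254321153377,
  14644086690985911675572242869559118689587658427799992261932020417876349633349,
  10447748265433003949460426412585835185044559820800905673183455355971609692737,
  30083250504512171528341397803100426012358282444870613672963033439866113270803,
  24061270743117164873506063046752555098335497357468827397219601323503373403716,
  16340466869957800160259010755591159174141555530849571264954386542319015182914,
  14677316058886684981699109968589723593969997527939459759559225249672318714400,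
  38079778633823531492907110784824668088765148496994203867036192486360039493699,
  38080109857094054921804337721619191724999869185383027402501900385591081902193,
  45856901016440505206259414258225212246158586197415381375757602978366478512514,
  16484830693764780130917572681869468405300482232583792269438623648048000017444,
  66156389464085136269396156557807685386076850489300356671804298831862514680352,
  23082540000742778931564014719206386240032453775513814181659100596690529826144,
  10518636021196873599435441004346629123861671146580010765624317237476402989348,
  59743092679046282428091525650248404662183990637083622044554957075805880197252,
  45408440453368720511252427225933947690607400887402265320457127585552004155713,
  7407293713267304427235618726494930061443856132702634946584513461355238695957,
  38927398445587636466983728728520899243093216978854254143649626504470983890518,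
  22621391745954946876529024649646212350048854409685988590926112669044418094116,
  22363778321840975030350917819863569055052493772519064412039253195820300976650,
  66297996181988814238082436246197784400597270166861828709970254672423303000406,
  44357179142268302862920525413120730331545111912750778405102629472131181715505,
  51595509561588732715580877539114796733726309621010677627474156924240237371749,
  43650420458550987827148169669835752601192712946069219067581981970464151515680,
  31238866029980144977421103566944895282777805276414635501439096835315137193781,
  38051840304059649618537435174208621029705817671048718712104882440982923256886,
  3225195613495483261700451515348936104989328417003662794475304477540631528480,
  58436923751695400038446073528873792076030088389554995379401924865671467959074,
  8663219552932603996202827842340464247419953621310172110998097398160618362660,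
  30482204849785049729434209777208947530476816416749480214016571980814910292487,
  74017110258192565671097907388551678490407071567987645746028564720391938924594,
  30860152946337187919816506024869012932545100956042052459826729857808442213443,
  26352873051996548146041106341942936179153214059422235391919749395422639383652,
  22672968936509053762931062116407676272257055553326036172104746478181556700218,
  51691009777726001131427296550149015954065811049116334487184537473469451281680,
  2719441302711277402194749385306918485987086274106774773534098353369832759409,
  66530792492140064166800047850357599980528619113711755675473411221572879946514,
  3212480040783485200282587618679703991194959875902429618225760188082988020512,
  15893034019848649798678272878394884889241929715366470860330750314838639149910,
  2747671091472319583369454866812278463886999435621880482375823149336876028771,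
  44337302599370099692044472102819787478202374269231318305741851825738843775238,
  25877697794629690134524701015736444470092596716919165446085405502096141283861,
  51313270058611025483295839466089607840065369393302587335503713715653229892436,
  25446188400395801888432415071956956160667426855141004885200110950553082007584,
  31782268462366449753092675295735234661937206928676630574904423697141466354742,
  30452190396975617344552175229731819732317157270176416702888183127323711058262,
  10445746299010975870840471294538557175720330675850798499074322208132870310465,
  25875960301831674783780616084266431188407436766561441778326343388399373747588,
  31782509664784160218868609968660750489899771355018641645899705989922803812645,
  9140267482191646179364759739040442567170091074089592434232793649310527533398,
  15105452393630347030318775532420426293370962019741701769926424868293597995156,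
  44413283896947780152320923663770487612301039523349482221286267101553717543495,
  30885095810770502666975436691784135345075812370748499996199450569993346949216,
  51123954706379939135034466001571313633461887323389993706977707136844877358356,
  75820757379654687287075909115714344140277183946689578604767310148922773763719,
  51683184021325897663925758883173143129670782106730805794129670871912338924918,
  45406915377604690447036479157964152839483736941998202238864938065390673164816,
  3207091236757265165532620456793912029992907817171399909864820202241452631621,
  43888731124490986695717971723188828292693873644800828738573350361716760028950,
  44026779748795896432474542050931144467632361656016250998997603092199201023655,
  33614860853672576234580797718583340602453120209581883967162854136970539476505,
  10103392398249898993589812653168262202080686517551554577881482096204310733925,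
  66985315038322449777098258997947323731871661809617822131113972857466759771509,
  58578538287233399449602955437978773753746223889301850725355187005861587591236,
  2730028639819831960443450058501488216782257977346288149004826504660186959904,
  29457540774883617056474953945704797110845137239784957792358849996402550940690,
  31783177464365815335085613400365045343058326608620932338317965725797042373642,
  8152295504798768738460876601795911462424306361459782625528466121142170960982,
  74265248335780508395606563908832370284669751029116329427309085070867812266148,
  9675946572169917782902107396289471615591365880741142653178183288086386249811,
  4134774397103190501374561053839372951102146208786036132950134438556033499523,
  59458496606311704428843744046263566196845064807433038825042430190739077243985,
  29660209319662462501423172415897219827338544066589185938668779074752768737603,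
  23086076394532598078891665293228414520596234731306063621447851336548061574166,
  66780317744183739007079565414731609481874378339659515029030606255326772660516,
  30909707524035347832178465143103656362217382811638463390077499927762157347395,
  29457541206269014670751685596858720097769982966151557707544676531003192333894,
  37098869222491968419037261324188850104492954736784711336314504933418694095625,
  40824023466895261209377085052028713871538912217784805551148846503838940898196,
  15382661470306360197291970652522693456954757062534060682499532252304074105930,
  14983528324208000995139038268992001009592310817868304998016815733041186099464,
  29607857469270121524940300301170952864465911858130236305082462868391856710152,
  74669416709485701986625824610608607613892750166529956612412443800793391568984,
  45317018981808454605174437846779269478135362540799409190682507374441742616148,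
  68476964877168239022218851905955164311221716350791245090035721541173419380850,
  14712717578015190497551757284895099925509777583606831653154722549604067612022,
  48426535172685264013016374539423804962960079927501965267720098791376402452594,
  3208754099202847433455735732056079655032437192988350428891891497217861252682,
  47250904989528519008236775975733047620464488687029373298886156714110258450950,
  75707686069360529773536486445461107314053858459612212233695127361904757446440,
  9675940557241067620800690568269594792492421392989191788505503094114807342246,
  25883009472274728273656158487780015858904856194340230209328072575213957964966,
  14702833569849029894546384670765593066634319270272655859327312256129294181396,
  73393395472558902894946692335299356324543742508634450787460687074673171912208,
  22363876738395269564033572552721094200337140454242117195687696214125532755216,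
  73393395473313903752984507496930299209662822628362695631898011888598491869961,
  73535534753464418660972486914832459230012249510742272528047967195132595877489,
  22704241067244542425579838039992713232807217133764182971317209681151924778130,
  51149125310064636726350154325519825281162167368917043718067266023951842820661,
  14955257023961594199484672443272065365063368493009266251030889389764913530401,
  9136415806955381713922073510419654465536711028516933537664714388111068701191,
  45413333226292456800178770896299709459854342090320339136327599478080816764424,
  9615245598166075919206396104256294935780274843586690846873533607600501895747,
  14675585880539538233850382882455137910173222786285900769470915871258888606786,
  14538428229072794223423425330284225144930122245097930828843655218872363323442,
  10917459792628018372492274097217030320253718543807848418354892354452945330209,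
  8664977334911674730021941080584613054165858154055975322914543354483829785112,
  15154594182172527292269373914352018814032107579363947879591652927078703239704,
  10889328440128045929601640837811588639653298323797073399344828434248196294977,
  58437165804732979751103921274597569607908176509660831786741345163446488962066,
  39023055917402489102862731484702463619223963752708010644044817073064555200801,
  43971537190150816574931020097084343251042924867424797060815205232396679403094,
  16481495380616111369026303095593055406101748055847838261755729193122483540064,
  43620606715377539084809371770544866039143372832485101698382726507192446747158,
  3705872572046796746899091727044021477445329321825193597477311279162130040881,
  1417074796511477062269048871399763241421952562350292176367331650138263324466,
  45862749043281805182689844186895629741336850909927687084347499159966250668881,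
  3169876096614170137813029310728649694268038200893584329222434658204364662117,
  29978695498801787094917538809238061898158641559262660461898597144948308591974,
  30537440148958595842776642866416770480022677238154118213433831941262289277442,
  37690776556023536268052416242488756197857111671928263663110280071040502871349,
  14537848898169877224775641440919045660776078722701160036591039780283364038211,
  24519028630829139190942075751180422168729478028434901068003973903299318669458,
  29603670213589067005456961039366197479028340204634090854228111609735723484933,
  74236978704931865771411534616141126355411315088965378360186274652650662539782,
  73393395500289860325805434194019142126772349092047112681143707816479264424819,
  38095364038004800805773276262693753348375114564003257431178538817793452230416,
  24091978709835001713404105616405132490603506742311658237531986966990045659987,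
  37830545821280126865855707224602449701371077950720812661647370909384979006517,
  43903059394347015668605289492136394382631883758214438442700494924432896262562,
  1030673190706302953778667787648492642625119738737097004829154052451757086241,
  22370844990185029433171252237146633806362739472038138313613128616253735372834,
  15155037269119785685469412013002374242490600742978763808462099272318612497432,
  15128880920946122610448563593191340366090124302742901433530112189791448686704,
  39991548491014264014389318542489508243446944144595955780858332124345698498148,
  50718237970612082311817611215329857748959882179064685823904711365682530695226,
  48134327669630744090757624857280685582215854987805523559025907376019515011424,
  45406908701153908359534126800465933963048479435518873602922776543331436034681,
  25883007320533984901136741616232767810534058026616122285863063167079517742661,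
  33134278881936833346763481778720322535814585361803432601649961035545922835524,
  9669995452261932365523449122468129228320218602784348206123520560609535607300,
  44811232642735107974976177132952373266263143899722970643731352696095293055346,
  36646577079253027268161756668109209220362352589887149682395860044864132896321,
  29895232867674667263433537025636289931530659758872658876654866315242174112628,
  30319547411648757820902435156666851258877023143758713236386613492552410948708,
  31782710595500288935733768852722490768966503803307540613972410922057631597880,
  11423261718349364940996871526352974111413801320060402636986740605903030403414,
  29570728179959519422508508905741584555513608113560171276341623582478540415140,
  52506087101609119178881787053128451949565943638081750244408585440002909149272,
  9675946483255840659503224593086744921486526624592898563010490114197985712193,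
  52583164450616302895193735538304222707504558171107738666102101827448515691908,
  45408474528420337578127717504354562339248656434819015047696879982853295730788,
  9675946673875236099504368783879341147520690185060796619852349191176576922645,
  52507614081320730507115680374405639356548401637819244143635996064461161578884,
  11382278823878982137342159023292578437386269945161807041430759695012596826912,
  74223769194311464967200687575416293491880482390426425031274586470754730419620,
  33630617970459822260004397396615253222476139859188616932736784381326261634213,
  3169876096614170137813029310728649694268038200893241217185362089446396486756,
  29978695498801787094917538809238061898158641559262660461898597144948308591974,
  24089256763363020379000432940144305197917935675778111766625796590293592707586,
  45410215339028964914957166197306174139862431623922418832401602036644042740792,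
  58550596063230686502326970041906846919684296236424998822089748942517180917093,
  51852804083708160912660191272781431642645170824151493146777422912216012714017,
  39991541589267917223825531107733646315252212117259642273316560212639836693537,
  51281743107022744986344551410796056074205785897260802409120206311368382949946,
  40472236846151135462291129759689951368634520464706106083165588264235531064330,
  44959669337311359680350335286381659553024691003960678077345488802099502921034,
  39051338788375740907602777477699622656017513685573605744755453835930008634724,
  43680214965420977068157145187778066665560933486674327474113570905813730992470,
  9136422717133400321280642898877465509514310260489443056750755405797982869284,
  23549201153795418320547699674437117776979553575149060654317218333837253367554,
  43680456863706800585043454007102893922418191714991348287501683423848202065478,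
  58635495223512254851520543098161193002447654826172961018130177733416196717110,
  45746033232010760210384184719751157273546285868399883929845661182048883586081,
  9074637935569881481576004836200636373786336332351645316255786638434868929395,
  43884989329530673234681466801440897292033029828823340580932219522628693984791,
  39050967285109942060960549257330303132365606581628414074170011966873361519973,
  29971400564765669450468068950390684869417135190373470062727435761273073112084,
  16347224119636503091665426331257416149212246826433943530204592996356548736050,
  23298439971834737799081002242843382260839281433297467612212528687923995906835,
  30405934752781993254797939690442833296612095174795007192494909883943264396324,
  38987704658995302283379527869484898068432135710545339970951719479486994002498,
  29971428171751056612723220185991810588649404247975212723206181380545197781284,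
  44367416590164164092680714463615765124759679090789630022331626175337301946674,
  29410978174866149396798522343779394544365440285885131647877149467093209915749,
  14537731108374637872465975625117814249062052652484897604736808798811882787330,
  24623783236095787609323601475091409772366500549974033487513283708610495602817,
  50776330454628597359312668442967194934865889943727923496811740790587640718888,
  74017568220183036396244558421663579806265587050686277831267087544179317293408,
  45860974458831640385710397794176154275308228648763547402696381928941476274771,
  37656059660329506214927222522914829504434426846207106646265553859617389376021,
  29999878060526023733531217303404645288591711706859346498980025891560836071746,
  18237452812738641943872270715565365985557044906329104213961085581937510793522,
  46604264065583192937381039023860629445717088800839865971334278597525185451079,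
  11341668489612374044087141964986887117278450886491531506995050248915995755107,
  65702876176477778822543088947471976052740513677739174728644055955965854618440,
  74017789076066133706843036757931315750364688916356971076425445831418436010369,
  23532974682883151103936551787475512535782531211686192457298037051923110199891,
  16829692015781553261354885798818530166081744174636345236905594121149156430885,
  24093736956650878038260037385930043573168349155827918654067762812137776616228,
  45814967746383262083347777555157286754323250194115444054009864365787514610725,
  66999862670901194471324009471098869469603718901365788402663887086452346209636,
  14707396059762581730923733629123299802069632780370974087043422386031154250851,
  24541548906451082876779234535584898261578402802969489822496210523580973478788,
  19115865749227689409559652352952088767918048701215401768371677225123973387336,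
  29999878033566077064732976176103665669810711122892565772851879295904421004330,
  45297358009737331666167334241547110479403914318128677476095094996502270525746,
  2724612340181517370648675690392299469251464657349158232773368901639447209251,
  15133832367969586060959579579599695715694023809816267353804572233517269811729,
  1424349332908357132488959765200432518266930568059642204905484405240041574920,
  29579477405176379591730117958778717893594533454363864581248316743989695026695,
  1876662612844318340226267674626681378205393059394865524868505992203632411671,
  66999973263676664329202793798113393145118049565312413919632423420678962955783,
  53123942724162979641209106745537036675244155986868794402423906703478535898195,
  29607857467053157528846451026629872065197405762813973262134523290614005762097,
  43620378934506116281373052229478227311109694270626092327506022972818482283272,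
  14763948378429145587409431031218282866262958205174485586177962524813932512836,
  2728144083620543395410171604100469306851815157274714294799146208187973391252,
  14679119010524519779184733619771427971897418612422329824935955936875586286353,
  39023054946462240952171537111119750907159472537580947906907862887885944655938,
  29661996544767936028008617210615248466579850604563158574604041874946864191297,
  66213304850244795866592043278260374352721467647502198080646433862425693012746,
  8723539548918150917736878975427097480980812474031676894764726661163109093682,
  16357872269064879616732270284703177469907228374356323620294859619787682038116,
  59743092679051656047597091645604843052273292693161085703542119394789652980803,
  39014433802847135094474160928371218251310524557111116770326745455857290008897,
  74269687316503407494025886725953458383842224635516132125423850456388573688854,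
  18661509483644315948546642366001591455404861780561927975884132184722252251810,
  43620267214074778950456491722978573468257463247703292157843523704930410079283,
  29407637455086377781241679222145489969784207839259519459446762594411030448449,
  39023058015131088334873140413082680587679014030641026361171837410763208754324,
  14763940391214976830047932597040510746463269117970610222885979680174119470660,
  19071810994450102337943596096781111419632388431566670923307700307752218997348,
  15391456093444817356995928048922264128014943686898567377877741907874224038980,
  9675946539077987040510832506648156853856725541731571473966824157231128527108,
  74224094366006567748794891230410224652782250487179906161283765724458133242228,
  45862742111195190300087265251661011930200295069175632336476700122797216793632,
  51603129815923335887097092959995702434535360655548736624872729838750632600933,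
  8764452639625527785598256583427334417600407890644165108646169190147153756448,
  3705872597866151633848417231226941686726716016208237873135054767212924569351,
  9678836617978252915478709107422900503902476619058856875309273131928388905011,
  24623672816579096130672068312269348303905669023399314620928391203945160716675,
  18634999439128262522284002818334200191559420240302987386234865208980973757993,
  32610863458726824308606762475877631329330108352060748772086372487172232270084,
  39022944574486276094529806661337148190958644596883839365668848411613300667395,
  4106443854154353328202161709508793989768967966253755716826577199512581316950,
  18161796276612314711752420386102588384401474165318833494124389332910744953703,
  1417060989650333306225733452586082999468611948423182007577176329887509055507,
  38927841013364757413721609078687270596250742580624073709742731806465063088961,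
  40343323735233345478936784876549189082673691155774043845953698984379508004657,
  22333722575561996542342920457816711517577833676122209511674884985210017088329,
  39022944528630492131577888344950046323273672082372161843748010290372123239176,
  30379459687101357342967189822185616558384490883846946246311689699779223426865,
  19087708322609022288091582101455440077361231734292027610854834780162430952547,
  9980946789478950692767444289524142179956578021370433442540375415592535147306,
  3176957288690781328284114353636309443419844774702157408219779034506836975985,
  51149155487822857498601856745740049767183165848741251785135330812381501719110,
  3650321783964615599392053321401112310459001710764257582675339848257145020692,
  15845314834552349930327669411650930726258930510963105499210412151463599960374,
  1424349332947823530855960566013766105057145072241595925289435617013022525715,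
  44445263166647453652107823037183246127789336571364688258185622516397905221127,
  16312309018882951824615563300632894232728937312642757832984587909698142480947,
  58635050849665195595865290260837971947634634278547008039887603127852029118001,
  22227830323133840889622624341221264328696607869666682064526471367875432625760,
  73393395473329887628229283690485419241239221212248043821298966003821322712070,
  65674715732664396059453948460995037334778308267672967222128757615409781880080,
  30362625629198109455978996001454150267783417326865104875743342566164030099552,
  30001196965852660349362832623619848067068650358013082553986084243428549997458,
  58841538289226300292017994923036283697714621291512564632383032874021244260918,
  7407293848593599221375586912726529496480256721763383049349986341720568242212,
  1021716574594499121014693844289402871350699315282604257321895431895521711702,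
  29522947415395499960463788144302044958212477614085622067192289764864557451282,
  15078938448349656461639159803989267176829885357066629209248756240041132515857,
  43678906604846140275296149611169941693430401064465198695533339299184631648792,
  66075449340484528624863887439880112974582987073830350807801434210688334845456,
  31725756690229711842693203650629263284770803526016456335790906839982611247140,
  15924938683284158726199088594342930605306981842494648884176297397050694260310,
  1395941396801373771130941545274197241491360577956906089985989172962407965732,
  22846036581530741378642051650040740239544605210550397719562115859181413221896,
  22817767028493875721756162947516947552875635981665358355403330793867801801073,
  15013246135892412157883701227552377136955245394353191850374461431624696344961,
  17736178219001285471302780828177075482919559769907237190247030433722031802401,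
  29938354486486897822954225129442418275119666666830997968901030975895202058786,
  45275795115382892440186779326733537292653192758451298173298356603962689679409,
  33176538550511431044968732018164181126248753195433955603898863579500193988965,
  43620151149708980436374353857435539615236101532600260009297046951117819888132,
  38902578083037526502960128823449592081016839730922497816638966963087676495649,
  66298317055048879063345582657823279622234712546756590783683330789560600850819,
  15841782020518822764880562335128389521198570693192859121731686051957378740546,
  1399496154409943188472581874909167728641736156014338700876103686221098058516,
  52507216368470428498502632599572117572926403447524015964438270949959264310792,
  23779353650671987371155427871378616296712902405610419125940448133028465689392,
  30362515005152993784231242086612742669711046365315329235499220882557825651748,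
  32185231440208580024475513624134718411300150204725366452187482773198481208097,
  15013356838595444203981544092551206579287826194379768195670320325126968656451,
  15394768555094489663355064487454093652589464481840894314316142226290341185329,
  22280405903129788370571501772730016020635176303040189847838151661798605075220,
  59762746636870107171191500887876034708416057617426422211277130859174689321249,
  22704580660235850168288402012654157791859025320655559714857391343773375804561,
  10921656030993987119706364452768978693344932175953255868445895397163072307510,
  22631884839972485123546020693592641131563752793531023820347155752841560719894,
  8175340406784718840241982495970943224389171975957218423053298319335640744997,
  15126656465509261109176506408474082896661850986736500257084450491576672854164,
  3705888901876468172838486782047016072161141556317206754634366950363191402608,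
  39466291971606492561070447364486444179475686566645470789928976285845468353843,
  45408447354591415387659596381375868356559463584092460601865027111037936108567,
  21886060773241486816325012868049623570316009338305720132077357354239720252773,
  23578916216699685243448613349395057239209123586267856660509383719746762973523,
  30363847433224192475675988467164796499549535836408219204876973536781290112577,
  938348686994497966321718079259535899673093555580220861914698258021229013289,
  38151709605020644338818438479834724786410412840397109512089747739535831406087,
  73876543167351355040414340815701185659696364825680878754926957494004087865939,
  57954691844638574423509186787562199167573472024856325645249418987612357936211,
  17711353789501272298047729095566721022857837379477460462466256747434347147632,
  46595547532559903032403032716424470542693218827945793093923208257420679120900,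
  21887834380614814652902792727891387002620631051051756760465394812419438641763,
  29459643659240582119329916599601292146890571610382064725704014082912270950740,
  52652063778522741665075507905806783315654856017820704728632083511746978128394,
  74267796238004285849995859340687948404793829561321854256188945415299247858516,
  58043488904443292380306599070464620218447241371092295152381235816576600785570,
  25423647436351954617755677941756902019421674218746884889547624580234342908272,
  74267796238004285849995859340687948417389280659586325222249080176389509220357,
  24542101607605369871055011553617635533025709032642688128549943076104767292066,
  16453764190695855098113467193070225733737244851095344701848929901383851980370,
  11380622623158407211239207690657973802030992523614525317347115124431649134129,
  19100096935693194559307900539601545484073614837401946333848216097966882243091,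
  74223929283742989395506848540848780788916296558546395054010992664030539289364,
  9963265024189073491246583679132715484844520391841272864804595408323609732128,
  15073307127660107837286175461948082715110370443360164325741458314765057226098,
  14735656575012530846820101585166428447043639615405384161329534292272371742048,
  9118982482767546264264757549735173810719130117141255519347908185800675893604,
  31386963435274741876820779044590935604917462722938685213318609364246228906148,
  8269452518367282902252017883015725774687941914007819060598461434369635869796,
  22422305645944187093529525014340926921177986676926996581512871723143187869795,
  58465662325352663622654370479734967003384939095757371259043377354042631074849,
  31782821451226071194562490198843167474313756919964594802117857898939941945377,
  52055443104051679290135857268063007743848082867366103085543767798963680854358,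
  8712496099464185440061705901416100300340598139005628300867985164589477286704,
  8629572508727432734628491172224868688879073665306087760216707483680303572324,
  14763948378429145480272571753198322219692275207242623612316236636838313616450,
  9963264916454892072931007656822384883176187229165873472626164005342932119972,
  32121514519620007839464268854861294223049393693582781511654644643466178557299,
  29633720063025188420602353864625741235070494809022154103525620691457175217284,
  18665315002758597811870628261692455881365344575405061918570215597629465248521,
  29999630699410864960936241862335654147871021629819606993469520509971099425044,
  60390984701925623980396160686474681036985047083296868884785990454845398005344,
  30321314691758090741640960233717931275060033725333965906472458855428074441025,
  67060861569505174161321801601168025787951793948226316530825164783183002468889,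
  15393223371567992892994389592111319312352324381178881136565245857663033643330,
  22396778241640376884978274015425760828708391829784237230916949548462460126724,
  45408482055516436240115321168354904782508707410651327082318902536953207728452,
  22654968856305906517628033462943065766192625025273177270484699249331115680837,
  11423261718362993393080386397514969676169173513377300519262765636521205867172,
  39919041332280420297770690914119782635226441809695276812025952947208717607076,
  9119168353339837823354512105244656907176525257492299988056428889216840143896,
  39023058015131088334873140388237152753053909712926854213546760423120564392473,
  37185520629033618979660133138951440560320033950998461232971072579160556062276,
  22227602096949958714269889580542100431812369115107355400919025571441903141942,
  46148299785748678896368294262695805291868233284277041568939010419369228572246,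
  8638399680236683405150094711838232245259745997643383777095725543956438680341,
  945429829217029067841940375338733655197804548957743176166246090314113828194,
  51286877159679677840788418530593815660043942534273102925688654585086702929672,
  66527803625979235354841982597574703441220161732587205716850501148578074882097,
  9108145830997928756048163915986693468361776556493389456466276725866360938548,
  10894747817029780370863949937992598681669146231197210298799966367248880391683,
  73812164902006182366246268505984049749810064340362335775223610134242907260931,
  44818070951089248404655006505728104713471268679120930822685349046017726963745,
  39069296186849517459070643814965887831441541712209584882898855239389936038245,
  38986485205943885665727332916168428763189824770030055197855107267209687406641,
  1883811048063532455219409867667783895746214025405472685655248395483188966452,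
  46602372498765070466918915409540268422517784883948925525533334362823941317480,
  4158312609760434907066786796122776161812439704420519633402482171027859477269,
  1475490522131974648106157188796687328265844414531830378254064790947723613746,
  29910195344371839945253331957142796268070680382198197706141653357693925337651,
  65845435248801611330480044817344897992579641759817230694312123785526300451633,
  8638289221840137002511527410283713394726530630982883604368260307430339653937,
  31754004543991709035372513034992386268495876474597797113302448935217946370211,
  24061271526514322412798668745667334299670122519813938239361870109411391385942,
  50718017546561837109005406379308291106883572393043542637213812171748700209730,
  59291902195263706907468544953086162915030310278629492785551187086715494946400,
  45862742111080390589374255472341164568655167868869572065938332194667776525104,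
  1032069609788184694519420349049265585056603340007936803221770498747303817493,
  24142427862186632048360625488302818437240796132142271159359388836747534342435,
  51602766611633326926845812363414273499253294803555656350455958873885179582232,
  51715634968987885590782861198921690357080462031349256187058993422321634517280,
  10417351648655254509135242610831592194652850340971988970653296341647781536129,
  57954574503443280257890645600418361589033750023999213001607931385468911977859,
  52199799675208020440722242638693556796121411632347139781906141782155632977700,
  73563161640120194315021548753153675356242143272254259923254497290712237814114,
  24652170142108370514445959319842950332567942762678964031571670609780150640945,
  16371675245957552160143038697454796181679269100602579687744503106045478115110,
  9965031763624982650847901030035478641667262410071458175607532041887971189575,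
  23578916649745472482199530519978387458930495210266140727589096921132548960371,
  37149998663077796143179455181742105231831001429713081355110530813264951400006,
  936444635761195363126166754551390855444963377736959238880507813295253824290,
  9198871848027208028636713451361671320952301733559926793556167710415811342664,
  11352236572717097072050794973389687413390267614859884856866436208981242697249,
  9134662771821444574489764615941161428376558277267160971989348925421459280450,
  39410300238299345388961355692950625518421998103495008511618289151469342069574,
  4104627511805517767128834509388180670677408059080301152237521577145239175703,
  21942634788364065802283648343818709645658123640777741535711650052477744677462,
  9677721156620450367946356485519414902534801733672108249594975117641481490755,
  16059218937191977279996469213954544717096053241754049525269372760397157831809,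
  4158312609866151951714663263790244998222576499304954439171058095141832235289,
  39807203780098721176695304672123162304967089728246998520428799973813597508658,
  22904142872674252414047486251804057160374059769641773200695079426172097028723,
  22362101235424584359092079544936837442685572347122801805034438480894622966177,
  3624080429819990270997402163093751853074141525240623249511617644158900253193,
  15211135870161862192595469015900360149627101459392199660365791414431540867862,
  16345898623770775025026705725112182926458529946786615976287954456868883416628,
  2754656063278138704264082747919938560556752120937457400169221366176141505380,
  9678843599122346392696870523976125369732391444008454913177940987325985416711,
  57954575366256580314730110989036366237765892555504550191775806638211136259458,
  1028360370074220452028559825900534090507010077671342138934829575222205032742,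
  51602766611809371722210723656363216825285106781469835666004479767690286275107,
  44357174515564348975997026059918626617824796267047829352823269557676543582581,
  50718127543146708947389698533581679006605505735153981902102961704634454333217,
  14538625880972518106105292386658678525100590982609404509974817218482755688032,
  936491963787953912482947371158372040709126059015756559465035644153188544930,
  3662833814850792677555357718721759843170467867455288463706714098606050284135,
  31388737888511557080264624637199710580749490467134848704691886285243023509256,
  15396533985116961702185326374884191185011896079550092234711374259987094311233,
  16087930203677053146014685206784104239153196316728109287947908802953133308182,
  16341683300234706733006860321981061160940895992861959764096240157583795690010,
  38056692748942061768180511804293722129183807976684521040239432201372255787306,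
  52055443097570134372104695196121193361912282393922259352769183737745373549108,
  45862230465264982276787012729033379479330004097733380923573364130635530645877,
  39410223500156518548231286877153918293286629084450416738104160170365500741457,
  7816651071919410870205020777390397223839667513993038998494306891852763136535,
  39069408348641358108145031654391490407287715491443530793279228063263538373986,
  51824219738297422679179423024526322027245015069205657972611458881294301402198,
  38906229106749640608241273961314506819772001367250730009633256138377504330034,
  8664909373671561436817311644796232836124431621877930004289972325397495448179,
  25076206512620602646717807041113828000240738658051420746171330187588939548186,
  9111989397793798299752600818206717710993550423165037331965894090710951602472,
  22902888531047358029961734682392875328302074756503969818717830444752311646217,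
  66080688478436803527070356933949484710256009951334063460790465115240021463457,
  50776225100430944477049298153094060669295379055729720796622309856120299098400,
  3212260125871613621236982815640718416138299911227687517533406548570621225013,
  25047936959584174222997653259929533433289934610424104711170491620892231288327,
  54295349338563500024490664612931846250598421473363555758393844490001836091433,
  39386811508685375455193666095401463661394868593102819026064021528756991726179,
  4106409345939867622978619493611809407578344344739281188423240238802905764515,
  9274327913327472318004050102962464753887830557655874650366720968715632018294,
  3632810625100837215279706899062918721928662848968934924648070050845704986900,
  39438458925394306338288525015483997177525360484509002367103079571769390048022,
  23719041915926572477526582484737945478872533414294536101769635176517931991831,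
  58604899327263254882290926569335559843872396602400184411962860801091472283206,
  19064662459819434015242498193969565324167762158920015155535099583051802439808,
  65870174892348786145591951883973311852231316408434149222914691218315560884755,
  115792089237316195370005993180812752469552167985099885456683978338568835324465]

def cert7 : List ℕ := [
  1905338971487391875990049681921069676603824145954384307685544554126727315970,
  58954393131368337883273373554461415010729105318519040180600950745173100467985,
  58578648065410771670015353279981255620518448136517066254578612236228721910145,
  50718133573011781418155734129065428730057856522848083073987958956224943235105,
  29970082686766294283131132669589370283468539191863557211534019631317122556176,
  32268158749863773485698347600244941018298758656374467413311124044642973274693,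
  1417060992912092437439816989194314645642076238609159484557546365314342068738,
  22252169537136152978742817407488889693489713379528428417125705523122460062561,
  39890330062112286467839060024188919218562535941220479875622331302258401087520,
  50746395801368138305666600581623631840428674248020601557414778625300381172552,
  8658327579508683267387650036807003975783399703467556619037865904018608641568,
  15977847794607397609271489062123355482253030260989537928574538984181639217667,
  51604419664237219125937875690393104978271724663894214275036362022080891466836,
  14702833461482691164400344499443634369062528007250887564950886069239663305845,
  31753886744077565143315620993091787186870054583171682078400856746611553936400,
  24543343353707448299977126604649193829505935022616876509054870669754724648769,
  16825748039852642406399264712489503658813321193030481729200647936558508566277,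
  2830552867586994591554989424900495626408977910253042441426961476572882884356,
  9106385878933058134768921258613025574102898347411228000988982341632691180594,
  22422306154702587492764301287234889115128354387911489746719283409882552828483,
  29517958714494615726890241007859027733067015818813640169842495754661570809888,
  14675550920191659007943346280018269147649009498791854617082973811006378492682,
  10898265124730202398748453970362803104811845784174528327884388379744476008514,
  918899594322263970284043471163341766307625255943088667688822876614203314963,
  37293545928654789345188742351697199500916860001486066218348510292980363465745,
  15891589364611730744285888622061610010962831769248421988544354212075567986258,
  54036306556112667235253874622562410530243874902113683934266821173547932853075,
  115792089237316195423570985008687907853269984665640564039457584007913129639927]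


def parL : Par := ⟨false, fun _ => 0, 0⟩
def par6 : Par := ⟨true, fun d => bif Nat.beq d 3 then 6 else bif Nat.beq d 4 then 5 else 0, 4⟩
def par7 : Par := ⟨true, fun d => bif Nat.beq d 3 then 7 else bif Nat.beq d 4 then 3 else bif Nat.beq d 5 then 1 else 0, 1⟩
def stL : St := ⟨4, [(1, 3), (2, 3), (3, 3)], [(0, 1), (0, 2), (0, 3)], [], []⟩
def st1 : St := ⟨1, [(0, 3)], [], [], []⟩

theorem checkL : (check parL 200 stL (digs certL)).isSome = true := by decide +kernel
theorem check7 : (check par7 200 st1 (digs cert7)).isSome = true := by decide +kernel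
theorem check6 : (check par6 200 st1 (digs cert6)).isSome = true := by decide +kernel

set_option linter.unusedSectionVars false
set_option linter.unusedVariables false
set_option linter.unusedSimpArgs false

/-! ### Basic facts about the helper functions -/

theorem mem'_iff (x : ℕ) (l : List ℕ) : mem' x l = true ↔ x ∈ l := by
  induction l with
  | nil => simp [mem']
  | cons y l ih => simp [mem', ih]

theorem mem'_false (x : ℕ) (l : List ℕ) : mem' x l = false ↔ x ∉ l := by
  rw [← mem'_iff, Bool.not_eq_true]

theorem mem_ins (x y : ℕ) (l : List ℕ) : y ∈ ins x l ↔ y = x ∨ y ∈ l := by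
  unfold ins
  cases h : mem' x l
  · simp
  · have := (mem'_iff x l).1 h
    simp only [cond_true]
    constructor
    · exact Or.inr
    · rintro (rfl | h') <;> assumption

theorem nodup_ins (x : ℕ) (l : List ℕ) (hl : l.Nodup) : (ins x l).Nodup := by
  unfold ins
  cases h : mem' x l
  · have := (mem'_false x l).1 h
    simp [this, hl]
  · simpa using hl

theorem nodup_nb (v : ℕ) (l : List (ℕ × ℕ)) : (nb v l).Nodup := by
  induction l with
  | nil => simp [nb]
  | cons p l ih =>
    obtain ⟨a, b⟩ := p
    unfold nb
    cases Nat.beq a v <;> cases Nat.beq b v <;> simp [ih, nodup_ins]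

theorem mem_nb (v j : ℕ) (l : List (ℕ × ℕ)) (h : j ∈ nb v l) : (v, j) ∈ l ∨ (j, v) ∈ l := by
  induction l with
  | nil => simp [nb] at h
  | cons p l ih =>
    obtain ⟨a, b⟩ := p
    unfold nb at h
    cases h1 : Nat.beq a v
    · cases h2 : Nat.beq b v
      · simp only [h1, h2, cond_false] at h
        rcases ih h with h | h <;> simp [h]
      · simp only [h1, h2, cond_false, cond_true, mem_ins] at h
        have := Nat.eq_of_beq_eq_true h2
        subst this
        rcases h with rfl | h
        · simp
        · rcases ih h with h | h <;> simp [h]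
    · simp only [h1, cond_true, mem_ins] at h
      have := Nat.eq_of_beq_eq_true h1
      subst this
      rcases h with rfl | h
      · simp
      · rcases ih h with h | h <;> simp [h]

theorem nb_cons (v j a b : ℕ) (l : List (ℕ × ℕ)) (h : j ∈ nb v l) : j ∈ nb v ((a, b) :: l) := by
  unfold nb
  cases Nat.beq a v <;> cases Nat.beq b v <;> simp [h, mem_ins]

theorem nb_self (a b : ℕ) (l : List (ℕ × ℕ)) : b ∈ nb a ((a, b) :: l) := by
  unfold nb
  simp [mem_ins]

theorem filt_eq (p : ℕ → Bool) (l : List ℕ) : filt p l = l.filter p := by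
  induction l with
  | nil => rfl
  | cons x l ih => cases h : p x <;> simp [filt, h, ih]

theorem len_eq (l : List ℕ) : len l = l.length := by
  induction l with
  | nil => rfl
  | cons x l ih => simp [len, ih]

theorem all'_iff (p : ℕ → Bool) (l : List ℕ) : all' p l = true ↔ ∀ x ∈ l, p x = true := by
  induction l with
  | nil => simp [all']
  | cons x l ih => simp [all', ih]

theorem allLt_iff (p : ℕ → Bool) (k : ℕ) : allLt p k = true ↔ ∀ j < k, p j = true := by
  induction k with
  | zero => simp [allLt]
  | succ k ih =>
    simp only [allLt, Bool.and_eq_true, ih]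
    constructor
    · rintro ⟨h1, h2⟩ j hj
      rcases Nat.lt_succ_iff_lt_or_eq.1 hj with h | rfl
      · exact h2 j h
      · exact h1
    · intro h
      exact ⟨h k (Nat.lt_succ_self k), fun j hj => h j (Nat.lt_succ_of_lt hj)⟩

theorem cntLt_eq (p : ℕ → Bool) (k : ℕ) :
    cntLt p k = ((Finset.range k).filter (fun i => p i = true)).card := by
  induction k with
  | zero => simp [cntLt]
  | succ k ih =>
    rw [Finset.range_add_one, Finset.filter_insert]
    cases h : p k <;> simp [cntLt, h, ih]

theorem sumLt_eq (g : ℕ → ℕ) (k : ℕ) : sumLt g k = ∑ i ∈ Finset.range k, g i := by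
  induction k with
  | zero => simp [sumLt]
  | succ k ih =>
    rw [Finset.sum_range_succ, ← ih]
    exact Nat.add_comm _ _

theorem blt_iff (a b : ℕ) : Nat.blt a b = true ↔ a < b := by
  simp [Nat.blt, Nat.succ_le_iff]

theorem mem_pairs (k : ℕ) (no : List (ℕ × ℕ)) (l : List ℕ) (p : ℕ × ℕ)
    (h : p ∈ pairs k no l) : p ∈ no ∨ (p.1 ∈ l ∧ p.2 = k) := by
  induction l with
  | nil => exact Or.inl h
  | cons i l ih =>
    simp only [pairs, List.mem_cons] at h
    rcases h with rfl | h
    · simp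
    · rcases ih h with h | h
      · exact Or.inl h
      · exact Or.inr ⟨List.mem_cons_of_mem _ h.1, h.2⟩

theorem fstep {α : Type} (x n : ℕ) (g : ℕ → α) (y : α) (h : y = g x) :
    (bif Nat.beq x n then g n else y) = g x := by
  cases hb : Nat.beq x n
  · simpa using h
  · have := Nat.eq_of_beq_eq_true hb
    subst this
    rfl

theorem force_eq {α : Type} (x : ℕ) (g : ℕ → α) : force x g = g x := by
  unfold force
  iterate 11 apply fstep
  rfl

theorem takeE_some {α : Type} (n : ℕ) (s : List ℕ) (acc : List (ℕ × ℕ))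
    (g : List (ℕ × ℕ) → List ℕ → Option α) (r : α) (h : takeE n s acc g = some r) :
    ∃ M s', g M s' = some r := by
  induction n generalizing s acc with
  | zero => exact ⟨acc, s, by simpa [takeE] using h⟩
  | succ n ih =>
    match s with
    | [] => simp [takeE] at h
    | [a] => simp [takeE] at h
    | a :: b :: s =>
      simp only [takeE, force_eq] at h
      exact ih _ _ h

/-! ### Semantics -/

section
variable {V : Type} [Fintype V] [DecidableEq V]

/-- Properties of (the graph of) a Hamiltonian cycle which are used. -/
structure HamLike (H : SimpleGraph V) : Prop where
  two : ∀ v, ∃ a b, a ≠ b ∧ ∀ u, H.Adj v u ↔ u = a ∨ u = b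
  conn : ∀ X : Finset V, X.Nonempty → (∀ x ∈ X, ∀ y, H.Adj x y → y ∈ X) → 11 ≤ X.card

/-- Every matching can be avoided by a Hamiltonian cycle. -/
def Good (F : SimpleGraph V) : Prop :=
  ∀ M : List (V × V), M.Pairwise (fun p q => p.1 ≠ q.1 ∧ p.1 ≠ q.2 ∧ p.2 ≠ q.1 ∧ p.2 ≠ q.2) →
    (∀ p ∈ M, F.Adj p.1 p.2) →
    ∃ H : SimpleGraph V, H ≤ F ∧ (∀ p ∈ M, ¬ H.Adj p.1 p.2) ∧ HamLike H

/-- The labelling `f` realises the state `st` in `F`. -/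
structure Sat (F : SimpleGraph V) [DecidableRel F.Adj] (st : St) (f : ℕ → V) : Prop where
  inj : ∀ i < st.k, ∀ j < st.k, f i = f j → i = j
  deg : ∀ i, dg st.deg i ≠ 0 → i < st.k ∧ F.degree (f i) = dg st.deg i
  yes : ∀ p ∈ st.yes, p.1 < st.k ∧ p.2 < st.k ∧ F.Adj (f p.1) (f p.2)
  no : ∀ p ∈ st.no, p.1 < st.k ∧ p.2 < st.k ∧ ¬ F.Adj (f p.1) (f p.2)
  sd : ∀ i ∈ st.sd, i < st.k ∧
    ∀ u, F.Adj (f i) u → F.degree u = 3 → ∃ j ∈ nb i st.yes, f j = u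

variable {F : SimpleGraph V} [DecidableRel F.Adj] {st : St} {f : ℕ → V}

theorem Sat.nb_yes (h : Sat F st f) {i j : ℕ} (hj : j ∈ nb i st.yes) :
    j < st.k ∧ i < st.k ∧ F.Adj (f i) (f j) := by
  rcases mem_nb _ _ _ hj with h1 | h1
  · have := h.yes _ h1
    exact ⟨this.2.1, this.1, this.2.2⟩
  · have := h.yes _ h1
    exact ⟨this.1, this.2.1, this.2.2.symm⟩

theorem Sat.card_image (h : Sat F st f) (l : List ℕ) (hl : l.Nodup) (hk : ∀ i ∈ l, i < st.k) :
    (l.toFinset.image f).card = l.length := by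
  rw [Finset.card_image_of_injOn, List.toFinset_card_of_nodup hl]
  intro a ha b hb hab
  simp only [List.coe_toFinset, Set.mem_ofPred_eq] at ha hb
  exact h.inj a (hk a ha) b (hk b hb) hab

theorem Sat.nb_sub (h : Sat F st f) (i : ℕ) :
    (nb i st.yes).toFinset.image f ⊆ F.neighborFinset (f i) := by
  intro u hu
  simp only [Finset.mem_image, List.mem_toFinset] at hu
  obtain ⟨j, hj, rfl⟩ := hu
  rw [SimpleGraph.mem_neighborFinset]
  exact (h.nb_yes hj).2.2

theorem Sat.nb_len (h : Sat F st f) (i : ℕ) : (nb i st.yes).length ≤ F.degree (f i) := by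
  rw [← h.card_image _ (nodup_nb _ _) (fun j hj => (h.nb_yes hj).1)]
  exact Finset.card_le_card (h.nb_sub i)

theorem Sat.closed (h : Sat F st f) {i : ℕ} (hc : closed st i = true) {u : V}
    (hu : F.Adj (f i) u) : ∃ j ∈ nb i st.yes, f j = u := by
  unfold RSR.closed at hc
  simp only [Bool.and_eq_true, blt_iff, Nat.ble_eq, len_eq] at hc
  have hd := (h.deg i (by omega)).2
  have := Finset.eq_of_subset_of_card_le (h.nb_sub i) (by
    rw [h.card_image _ (nodup_nb _ _) (fun j hj => (h.nb_yes hj).1)]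
    change F.degree (f i) ≤ _
    omega)
  have hm : u ∈ F.neighborFinset (f i) := by rwa [SimpleGraph.mem_neighborFinset]
  rw [← this] at hm
  simpa using hm

theorem Sat.isNo (h : Sat F st f) {i j : ℕ} (hi : i < st.k) (hj : j < st.k)
    (hn : isNo st i j = true) (hy : j ∉ nb i st.yes) (hy' : i ∉ nb j st.yes) :
    ¬ F.Adj (f i) (f j) := by
  intro ha
  unfold RSR.isNo at hn
  simp only [Bool.or_eq_true, mem'_iff] at hn
  rcases hn with (hn | hn) | hn
  · rcases mem_nb _ _ _ hn with h1 | h1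
    · exact (h.no _ h1).2.2 ha
    · exact (h.no _ h1).2.2 ha.symm
  · obtain ⟨l, hl, hl'⟩ := h.closed hn ha
    have := h.inj l (h.nb_yes hl).1 j hj hl'
    exact hy (this ▸ hl)
  · obtain ⟨l, hl, hl'⟩ := h.closed hn ha.symm
    have := h.inj l (h.nb_yes hl).1 i hi hl'
    exact hy' (this ▸ hl)

theorem mem_nb_of (v j : ℕ) (l : List (ℕ × ℕ)) (h : (v, j) ∈ l ∨ (j, v) ∈ l) : j ∈ nb v l := by
  induction l with
  | nil => simp at h
  | cons p l ih =>
    obtain ⟨a, b⟩ := p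
    unfold nb
    cases h1 : Nat.beq a v
    · have h1' := Nat.ne_of_beq_eq_false h1
      cases h2 : Nat.beq b v
      · have h2' := Nat.ne_of_beq_eq_false h2
        simp only [cond_false]
        apply ih
        simp only [List.mem_cons, Prod.mk.injEq] at h
        tauto
      · have h2' := Nat.eq_of_beq_eq_true h2
        simp only [cond_false, cond_true, mem_ins]
        simp only [List.mem_cons, Prod.mk.injEq] at h
        tauto
    · have h1' := Nat.eq_of_beq_eq_true h1
      simp only [cond_true, mem_ins]
      simp only [List.mem_cons, Prod.mk.injEq] at h
      rcases h with (h | h) | (h | h)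
      · exact Or.inl h.2
      · exact Or.inr (ih (Or.inl h))
      · left; omega
      · exact Or.inr (ih (Or.inr h))

theorem nb_symm {v j : ℕ} {l : List (ℕ × ℕ)} (h : j ∈ nb v l) : v ∈ nb j l :=
  mem_nb_of _ _ _ (mem_nb _ _ _ h).symm

/-! ### Soundness of the refutation of Hamiltonicity -/

theorem HamLike.le_two {H : SimpleGraph V} (hH : HamLike H) (v : V) (X : Finset V)
    (hX : ∀ x ∈ X, H.Adj v x) : X.card ≤ 2 := by
  obtain ⟨a, b, -, h⟩ := hH.two v
  calc X.card ≤ ({a, b} : Finset V).card := Finset.card_le_card (by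
        intro x hx
        have := (h x).1 (hX x hx)
        simpa using this)
    _ ≤ 2 := Finset.card_le_two

theorem HamLike.two_le {H : SimpleGraph V} (hH : HamLike H) (v : V) (X : Finset V)
    (hX : ∀ x, H.Adj v x → x ∈ X) : 2 ≤ X.card := by
  obtain ⟨a, b, hab, h⟩ := hH.two v
  rw [← Finset.card_pair hab]
  apply Finset.card_le_card
  intro x hx
  simp only [Finset.mem_insert, Finset.mem_singleton] at hx
  exact hX x ((h x).2 hx)

theorem HamLike.mem_of_two {H : SimpleGraph V} (hH : HamLike H) (v : V) (X : Finset V)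
    (hX : ∀ x ∈ X, H.Adj v x) (h2 : 2 ≤ X.card) (y : V) (hy : H.Adj v y) : y ∈ X := by
  by_contra hn
  have := hH.le_two v (insert y X) (by
    intro x hx
    rcases Finset.mem_insert.1 hx with rfl | hx
    · exact hy
    · exact hX x hx)
  rw [Finset.card_insert_of_notMem hn] at this
  omega

variable {H : SimpleGraph V}

/-- Meaning of the list of edges known to belong to the cycle. -/
def InOK (H : SimpleGraph V) (k : ℕ) (f : ℕ → V) (hin : List (ℕ × ℕ)) : Prop :=
  ∀ p ∈ hin, p.1 < k ∧ p.2 < k ∧ H.Adj (f p.1) (f p.2)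

def OutOK (H : SimpleGraph V) (f : ℕ → V) (hout : List (ℕ × ℕ)) : Prop :=
  ∀ p ∈ hout, ¬ H.Adj (f p.1) (f p.2)

theorem InOK.nb {k : ℕ} {hin : List (ℕ × ℕ)} (h : InOK H k f hin) {i j : ℕ}
    (hj : j ∈ nb i hin) : j < k ∧ H.Adj (f i) (f j) := by
  rcases mem_nb _ _ _ hj with h1 | h1
  · exact ⟨(h _ h1).2.1, (h _ h1).2.2⟩
  · exact ⟨(h _ h1).1, (h _ h1).2.2.symm⟩

theorem isCyc_sound (h : Sat F st f) (hH : HamLike H) {hin : List (ℕ × ℕ)}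
    (hi : InOK H st.k f hin) (X : List ℕ) (hc : isCyc hin X = true) : False := by
  match X, hc with
  | x :: l, hc =>
    unfold isCyc at hc
    simp only [Bool.and_eq_true, Nat.ble_eq, len_eq, all'_iff, filt_eq] at hc
    have hcl := hH.conn ((x :: l).toFinset.image f) (by simp) (by
      intro v hv y hy
      simp only [Finset.mem_image, List.mem_toFinset] at hv
      obtain ⟨i, hil, rfl⟩ := hv
      have h2 := hc.2 i hil
      set L := (nb i hin).filter (fun j => mem' j (x :: l)) with hL
      have hm := hH.mem_of_two (f i) (L.toFinset.image f) (by
        intro z hz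
        simp only [Finset.mem_image, List.mem_toFinset] at hz
        obtain ⟨j, hj, rfl⟩ := hz
        rw [hL, List.mem_filter] at hj
        exact (hi.nb hj.1).2) (by
        rw [h.card_image L ((nodup_nb _ _).filter _) (by
          intro j hj
          rw [hL, List.mem_filter] at hj
          exact (hi.nb hj.1).1)]
        exact h2) y hy
      simp only [Finset.mem_image, List.mem_toFinset] at hm ⊢
      obtain ⟨j, hj, rfl⟩ := hm
      rw [hL, List.mem_filter, mem'_iff] at hj
      exact ⟨j, hj.2, rfl⟩)
    have h1 : ((x :: l).toFinset.image f).card ≤ (x :: l).length :=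
      Finset.card_image_le.trans (List.toFinset_card_le _)
    omega

theorem badIn_sound (h : Sat F st f) (hH : HamLike H) {hin : List (ℕ × ℕ)}
    (hi : InOK H st.k f hin) (a b : ℕ) (hc : badIn a b hin = true) : False := by
  have key : ∀ i, 3 ≤ (nb i hin).length → False := by
    intro i h3
    have := hH.le_two (f i) ((nb i hin).toFinset.image f) (by
      intro z hz
      simp only [Finset.mem_image, List.mem_toFinset] at hz
      obtain ⟨j, hj, rfl⟩ := hz
      exact (hi.nb hj).2)
    rw [h.card_image _ (nodup_nb _ _) (fun j hj => (hi.nb hj).1)] at this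
    omega
  unfold badIn at hc
  simp only [Bool.or_eq_true, Nat.ble_eq, len_eq] at hc
  rcases hc with (hc | hc) | hc
  · exact key _ hc
  · exact key _ hc
  · exact isCyc_sound h hH hi _ hc

theorem under_sound (h : Sat F st f) (hF : H ≤ F) (hH : HamLike H) {hout : List (ℕ × ℕ)}
    (ho : OutOK H f hout) (v : ℕ) (hc : under st v hout = true) : False := by
  unfold under at hc
  simp only [Bool.and_eq_true, Nat.ble_eq, len_eq, filt_eq] at hc
  set L := (nb v st.yes).filter (fun j => !mem' j (nb v hout)) with hL
  have := hH.two_le (f v) (L.toFinset.image f) (by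
    intro x hx
    obtain ⟨j, hj, rfl⟩ := h.closed hc.1 (hF hx)
    simp only [Finset.mem_image, List.mem_toFinset]
    refine ⟨j, ?_, rfl⟩
    rw [hL, List.mem_filter]
    refine ⟨hj, ?_⟩
    rw [Bool.not_eq_true', mem'_false]
    intro hj'
    rcases mem_nb _ _ _ hj' with h1 | h1
    · exact ho _ h1 hx
    · exact ho _ h1 hx.symm)
  have h1 : (L.toFinset.image f).card ≤ L.length :=
    Finset.card_image_le.trans (List.toFinset_card_le _)
  omega

theorem badOut_sound (h : Sat F st f) (hF : H ≤ F) (hH : HamLike H) {hout : List (ℕ × ℕ)}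
    (ho : OutOK H f hout) (a b : ℕ) (hc : badOut st a b hout = true) : False := by
  unfold badOut at hc
  simp only [Bool.or_eq_true] at hc
  rcases hc with hc | hc
  · exact under_sound h hF hH ho _ hc
  · exact under_sound h hF hH ho _ hc

theorem refute_sound (h : Sat F st f) (hF : H ≤ F) (hH : HamLike H) (es : List (ℕ × ℕ)) :
    ∀ hin hout : List (ℕ × ℕ), InOK H st.k f hin → OutOK H f hout →
      refute st es hin hout = true → False := by
  induction es with
  | nil => intro hin hout _ _ hc; simp [refute] at hc
  | cons p es ih =>
    obtain ⟨a, b⟩ := p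
    intro hin hout hi ho hc
    unfold refute at hc
    simp only [Bool.and_eq_true, blt_iff] at hc
    obtain ⟨⟨ha, hb⟩, hc⟩ := hc
    have hin' : H.Adj (f a) (f b) → InOK H st.k f ((a, b) :: hin) := by
      intro hadj p hp
      rcases List.mem_cons.1 hp with rfl | hp
      · exact ⟨ha, hb, hadj⟩
      · exact hi p hp
    have hout' : ¬ H.Adj (f a) (f b) → OutOK H f ((a, b) :: hout) := by
      intro hadj p hp
      rcases List.mem_cons.1 hp with rfl | hp
      · exact hadj
      · exact ho p hp
    cases h1 : badIn a b ((a, b) :: hin) <;> cases h2 : badOut st a b ((a, b) :: hout) <;>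
      simp only [h1, h2, cond_true, cond_false] at hc
    · exact ih _ _ hi ho hc
    · by_cases hadj : H.Adj (f a) (f b)
      · exact ih _ _ (hin' hadj) ho hc
      · exact badOut_sound h hF hH (hout' hadj) a b h2
    · by_cases hadj : H.Adj (f a) (f b)
      · exact badIn_sound h hH (hin' hadj) a b h1
      · exact ih _ _ hi (hout' hadj) hc
    · by_cases hadj : H.Adj (f a) (f b)
      · exact badIn_sound h hH (hin' hadj) a b h1
      · exact badOut_sound h hF hH (hout' hadj) a b h2

theorem isM_sound (h : Sat F st f) (M : List (ℕ × ℕ)) : ∀ used : List ℕ, (∀ i ∈ used, i < st.k) →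
    isM st M used = true →
      (M.map (fun p => (f p.1, f p.2))).Pairwise
        (fun p q => p.1 ≠ q.1 ∧ p.1 ≠ q.2 ∧ p.2 ≠ q.1 ∧ p.2 ≠ q.2) ∧
      (∀ p ∈ M, F.Adj (f p.1) (f p.2) ∧ p.1 < st.k ∧ p.2 < st.k ∧ p.1 ∉ used ∧ p.2 ∉ used) := by
  induction M with
  | nil => intro used _ _; simp
  | cons p M ih =>
    obtain ⟨a, b⟩ := p
    intro used hu hc
    unfold isM at hc
    simp only [Bool.and_eq_true, mem'_iff, Bool.not_eq_true', mem'_false] at hc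
    obtain ⟨⟨⟨h1, h2⟩, h3⟩, h4⟩ := hc
    have h5 := h.nb_yes h1
    obtain ⟨i1, i2⟩ := ih (a :: b :: used) (by
      intro i hi
      simp only [List.mem_cons] at hi
      rcases hi with rfl | rfl | hi
      · exact h5.2.1
      · exact h5.1
      · exact hu i hi) h4
    constructor
    · rw [List.map_cons, List.pairwise_cons]
      refine ⟨?_, i1⟩
      intro q hq
      rw [List.mem_map] at hq
      obtain ⟨p, hp, rfl⟩ := hq
      obtain ⟨-, j1, j2, j3, j4⟩ := i2 p hp
      simp only [List.mem_cons, not_or] at j3 j4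
      refine ⟨?_, ?_, ?_, ?_⟩ <;> intro hh
      · exact j3.1 (h.inj _ h5.2.1 _ j1 hh).symm
      · exact j4.1 (h.inj _ h5.2.1 _ j2 hh).symm
      · exact j3.2.1 (h.inj _ h5.1 _ j1 hh).symm
      · exact j4.2.1 (h.inj _ h5.1 _ j2 hh).symm
    · intro p hp
      rcases List.mem_cons.1 hp with rfl | hp
      · exact ⟨h5.2.2, h5.2.1, h5.1, h2, h3⟩
      · obtain ⟨j0, j1, j2, j3, j4⟩ := i2 p hp
        simp only [List.mem_cons, not_or] at j3 j4
        exact ⟨j0, j1, j2, j3.2.2, j4.2.2⟩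

theorem kill_sound (hG : Good F) (h : Sat F st f) (M o : List (ℕ × ℕ))
    (h1 : isM st M [] = true) (h2 : refute st o [] M = true) : False := by
  obtain ⟨i1, i2⟩ := isM_sound h M [] (by simp) h1
  obtain ⟨H, hF, hM, hH⟩ := hG _ i1 (by
    intro q hq
    rw [List.mem_map] at hq
    obtain ⟨p, hp, rfl⟩ := hq
    exact (i2 p hp).1)
  refine refute_sound h hF hH o [] M (by intro p hp; simp at hp) ?_ h2
  intro p hp
  exact hM (f p.1, f p.2) (List.mem_map.2 ⟨p, hp, rfl⟩)

/-! ### Soundness of the search -/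

theorem Sat.addYes (h : Sat F st f) {i j : ℕ} (hi : i < st.k) (hj : j < st.k)
    (ha : F.Adj (f i) (f j)) : Sat F (addYes st i j) f where
  inj := h.inj
  deg := h.deg
  yes := by
    intro p hp
    rcases List.mem_cons.1 hp with rfl | hp
    · exact ⟨hi, hj, ha⟩
    · exact h.yes p hp
  no := h.no
  sd := by
    intro l hl
    refine ⟨(h.sd l hl).1, fun u h1 h2 => ?_⟩
    obtain ⟨m, hm, hm'⟩ := (h.sd l hl).2 u h1 h2
    exact ⟨m, nb_cons _ _ _ _ _ hm, hm'⟩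

theorem Sat.addNo (h : Sat F st f) {i j : ℕ} (hi : i < st.k) (hj : j < st.k)
    (ha : ¬ F.Adj (f i) (f j)) : Sat F (addNo st i j) f where
  inj := h.inj
  deg := h.deg
  yes := h.yes
  no := by
    intro p hp
    rcases List.mem_cons.1 hp with rfl | hp
    · exact ⟨hi, hj, ha⟩
    · exact h.no p hp
  sd := h.sd

theorem inj_update (h : Sat F st f) {u : V} (hu : ∀ i < st.k, f i ≠ u) :
    ∀ i < st.k + 1, ∀ j < st.k + 1,
      Function.update f st.k u i = Function.update f st.k u j → i = j := by
  intro i hi j hj hij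
  rcases Nat.lt_succ_iff_lt_or_eq.1 hi with hi | rfl <;>
    rcases Nat.lt_succ_iff_lt_or_eq.1 hj with hj | rfl
  · rw [Function.update_of_ne hi.ne, Function.update_of_ne hj.ne] at hij
    exact h.inj i hi j hj hij
  · rw [Function.update_of_ne hi.ne, Function.update_self] at hij
    exact absurd hij (hu i hi)
  · rw [Function.update_of_ne hj.ne, Function.update_self] at hij
    exact absurd hij.symm (hu j hj)
  · rfl

theorem Sat.addB (h : Sat F st f) {u : V} (hu : ∀ i < st.k, f i ≠ u) (d : ℕ)
    (hd : d ≠ 0 → F.degree u = d) : Sat F (addB st d) (Function.update f st.k u) where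
  inj := inj_update h hu
  deg := by
    intro i hi
    unfold RSR.addB at hi ⊢
    simp only [dg] at hi ⊢
    cases hb : Nat.beq st.k i
    · simp only [hb, cond_false] at hi ⊢
      have := h.deg i hi
      rw [Function.update_of_ne this.1.ne]
      exact ⟨Nat.lt_succ_of_lt this.1, this.2⟩
    · have := Nat.eq_of_beq_eq_true hb
      subst this
      simp only [hb, cond_true] at hi ⊢
      rw [Function.update_self]
      exact ⟨Nat.lt_succ_self _, hd hi⟩
  yes := by
    intro p hp
    have := h.yes p hp
    rw [Function.update_of_ne this.1.ne, Function.update_of_ne this.2.1.ne]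
    exact ⟨Nat.lt_succ_of_lt this.1, Nat.lt_succ_of_lt this.2.1, this.2.2⟩
  no := by
    intro p hp
    have := h.no p hp
    rw [Function.update_of_ne this.1.ne, Function.update_of_ne this.2.1.ne]
    exact ⟨Nat.lt_succ_of_lt this.1, Nat.lt_succ_of_lt this.2.1, this.2.2⟩
  sd := by
    intro i hi
    have := h.sd i hi
    rw [Function.update_of_ne this.1.ne]
    refine ⟨Nat.lt_succ_of_lt this.1, fun w h1 h2 => ?_⟩
    obtain ⟨j, hj, hj'⟩ := this.2 w h1 h2
    refine ⟨j, hj, ?_⟩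
    rw [Function.update_of_ne (h.nb_yes hj).1.ne]
    exact hj'

theorem Sat.addS (h : Sat F st f) {u : V} (hu : ∀ i < st.k, f i ≠ u)
    (hd : F.degree u = 3) : Sat F (addS st) (Function.update f st.k u) where
  inj := (h.addB hu 3 (fun _ => hd)).inj
  deg := (h.addB hu 3 (fun _ => hd)).deg
  yes := (h.addB hu 3 (fun _ => hd)).yes
  no := by
    intro p hp
    rcases mem_pairs _ _ _ _ hp with hp | ⟨h1, h2⟩
    · exact (h.addB hu 3 (fun _ => hd)).no p hp
    · have := h.sd _ h1
      rw [h2, Function.update_self, Function.update_of_ne this.1.ne]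
      refine ⟨Nat.lt_succ_of_lt this.1, Nat.lt_succ_self _, fun hadj => ?_⟩
      obtain ⟨j, hj, hj'⟩ := this.2 u hadj hd
      exact hu j (h.nb_yes hj).1 hj'
  sd := (h.addB hu 3 (fun _ => hd)).sd

theorem Sat.canFresh (h : Sat F st f) {i : ℕ} (hc : canFresh st i = true) :
    i < st.k ∧ ∃ u, F.Adj (f i) u ∧ ∀ j < st.k, f j ≠ u := by
  unfold RSR.canFresh at hc
  simp only [Bool.and_eq_true, blt_iff, len_eq, allLt_iff, Bool.or_eq_true, mem'_iff,
    Nat.beq_eq] at hc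
  obtain ⟨⟨h1, h2⟩, h3⟩ := hc
  refine ⟨h1, ?_⟩
  have hd := (h.deg i (by omega)).2
  have : ∃ u ∈ F.neighborFinset (f i), u ∉ (nb i st.yes).toFinset.image f := by
    by_contra hcon
    push Not at hcon
    have hle := Finset.card_le_card (show F.neighborFinset (f i) ⊆ _ from hcon)
    rw [h.card_image _ (nodup_nb _ _) (fun j hj => (h.nb_yes hj).1)] at hle
    change F.degree (f i) ≤ _ at hle
    omega
  obtain ⟨u, hu1, hu2⟩ := this
  rw [SimpleGraph.mem_neighborFinset] at hu1
  refine ⟨u, hu1, ?_⟩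
  rintro j hj rfl
  have hj' : j ∉ nb i st.yes := fun hm => hu2 (by
    simp only [Finset.mem_image, List.mem_toFinset]
    exact ⟨j, hm, rfl⟩)
  rcases h3 j hj with (rfl | h4) | h4
  · exact F.loopless.irrefl _ hu1
  · exact hj' h4
  · exact h.isNo h1 hj h4 hj' (fun hm => hj' (nb_symm hm)) hu1

theorem Sat.canFreshS (h : Sat F st f) {i : ℕ} (hc : canFreshS st i = true) :
    i < st.k ∧ ((∃ u, F.Adj (f i) u ∧ F.degree u = 3 ∧ ∀ j < st.k, f j ≠ u) ∨
      Sat F (addSd st i) f) := by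
  unfold RSR.canFreshS at hc
  simp only [Bool.and_eq_true, blt_iff, allLt_iff, Bool.or_eq_true, mem'_iff, Nat.beq_eq,
    Bool.not_eq_true'] at hc
  obtain ⟨h1, h3⟩ := hc
  refine ⟨h1, ?_⟩
  by_cases hex : ∃ u, F.Adj (f i) u ∧ F.degree u = 3 ∧ ∀ j < st.k, f j ≠ u
  · exact Or.inl hex
  · right
    push Not at hex
    refine ⟨h.inj, h.deg, h.yes, h.no, ?_⟩
    intro l hl
    rcases List.mem_cons.1 hl with rfl | hl
    · refine ⟨h1, fun u hu hd => ?_⟩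
      obtain ⟨j, hj, rfl⟩ := hex u hu hd
      refine ⟨j, ?_, rfl⟩
      change j ∈ nb l st.yes
      by_contra hj'
      rcases h3 j hj with ((rfl | h4) | h4) | h4
      · exact F.loopless.irrefl _ hu
      · exact hj' h4
      · exact h.isNo h1 hj h4 hj' (fun hm => hj' (nb_symm hm)) hu
      · have h5 := Nat.ne_of_beq_eq_false h4.1
        have := (h.deg j (Nat.ne_of_beq_eq_false h4.2)).2
        omega
    · exact h.sd l hl

/-- The global facts used by the search. -/
structure Ctx (P : Par) (F : SimpleGraph V) [DecidableRel F.Adj] : Prop where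
  good : Good F
  degs : P.lem = true → ∀ v, F.degree v = 3 ∨ F.degree v = 4 ∨ F.degree v = 5
  cnt : P.lem = true → ∀ d, (Finset.univ.filter (fun v => F.degree v = d)).card = P.n d
  two : P.lem = true → ∀ v, ((F.neighborFinset v).filter (fun u => F.degree u = 3)).card ≤ 2
  slack : P.lem = true → ∑ v ∈ Finset.univ.filter (fun v => F.degree v = 3),
    (2 - ((F.neighborFinset v).filter (fun u => F.degree u = 3)).card) ≤ P.slack

theorem Sat.nbS (h : Sat F st f) (i : ℕ) : (nbS st i).length ≤
    ((F.neighborFinset (f i)).filter (fun u => F.degree u = 3)).card := by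
  unfold RSR.nbS
  rw [filt_eq]
  rw [← h.card_image _ ((nodup_nb _ _).filter _)
    (fun j hj => (h.nb_yes (List.mem_filter.1 hj).1).1)]
  apply Finset.card_le_card
  intro u hu
  simp only [Finset.mem_image, List.mem_toFinset, List.mem_filter, Nat.beq_eq] at hu
  obtain ⟨j, ⟨hj, hd⟩, rfl⟩ := hu
  rw [Finset.mem_filter, SimpleGraph.mem_neighborFinset]
  exact ⟨(h.nb_yes hj).2.2, by rw [(h.deg j (by omega)).2, hd]⟩

theorem Sat.nbS_sd (h : Sat F st f) (hdeg : ∀ v, F.degree v = 3 → ∀ j, f j = v → j < st.k →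
    dg st.deg j = 3) (i : ℕ) (hi : i ∈ st.sd) :
    ((F.neighborFinset (f i)).filter (fun u => F.degree u = 3)).card ≤ (RSR.nbS st i).length := by
  unfold RSR.nbS
  rw [filt_eq]
  rw [← h.card_image _ ((nodup_nb _ _).filter _)
    (fun j hj => (h.nb_yes (List.mem_filter.1 hj).1).1)]
  apply Finset.card_le_card
  intro u hu
  rw [Finset.mem_filter, SimpleGraph.mem_neighborFinset] at hu
  obtain ⟨j, hj, rfl⟩ := (h.sd i hi).2 u hu.1 hu.2
  simp only [Finset.mem_image, List.mem_toFinset, List.mem_filter, Nat.beq_eq]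
  exact ⟨j, ⟨hj, hdeg _ hu.2 j rfl (h.nb_yes hj).1⟩, rfl⟩

theorem all_deg (h : Sat F st f) (hp : allLt (fun i => Nat.blt 0 (dg st.deg i)) st.k = true) :
    ∀ j < st.k, F.degree (f j) = dg st.deg j := by
  intro j hj
  rw [allLt_iff] at hp
  have := hp j hj
  rw [blt_iff] at this
  exact (h.deg j (by omega)).2

theorem cnt_sound (h : Sat F st f) (d : ℕ) (hd : 0 < d) :
    cntLt (fun j => Nat.beq (dg st.deg j) d) st.k ≤
      (Finset.univ.filter (fun v => F.degree v = d)).card := by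
  rw [cntLt_eq]
  apply Finset.card_le_card_of_injOn f
  · intro i hi
    simp only [Finset.coe_filter, Finset.mem_range, Nat.beq_eq, Set.mem_ofPred_eq] at hi
    simp only [Finset.coe_filter, Finset.mem_univ, true_and, Set.mem_ofPred_eq]
    rw [(h.deg i (by omega)).2, hi.2]
  · intro i hi j hj hij
    simp only [Finset.coe_filter, Finset.mem_range, Nat.beq_eq, Set.mem_ofPred_eq] at hi hj
    exact h.inj i hi.1 j hj.1 hij

theorem fresh_three (h : Sat F st f)
    (hp : allLt (fun i => Nat.blt 0 (dg st.deg i)) st.k = true)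
    (hlt : cntLt (fun j => Nat.beq (dg st.deg j) 3) st.k <
      (Finset.univ.filter (fun v => F.degree v = 3)).card) :
    ∃ u, F.degree u = 3 ∧ ∀ j < st.k, f j ≠ u := by
  by_contra hcon
  push Not at hcon
  rw [cntLt_eq] at hlt
  have hle : (Finset.univ.filter (fun v => F.degree v = 3)).card ≤
      (((Finset.range st.k).filter (fun j => Nat.beq (dg st.deg j) 3 = true)).image f).card := by
    apply Finset.card_le_card
    intro u hu
    simp only [Finset.mem_filter, Finset.mem_univ, true_and] at hu
    obtain ⟨j, hj, rfl⟩ := hcon u hu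
    simp only [Finset.mem_image, Finset.mem_filter, Finset.mem_range, Nat.beq_eq]
    exact ⟨j, ⟨hj, by rw [← all_deg h hp j hj, hu]⟩, rfl⟩
  have := hle.trans Finset.card_image_le
  omega

theorem deficit_sound (h : Sat F st f)
    (hp : allLt (fun i => Nat.blt 0 (dg st.deg i)) st.k = true) :
    deficit st ≤ ∑ v ∈ Finset.univ.filter (fun v => F.degree v = 3),
      (2 - ((F.neighborFinset v).filter (fun u => F.degree u = 3)).card) := by
  unfold deficit
  rw [sumLt_eq]
  have hdeg : ∀ v, F.degree v = 3 → ∀ j, f j = v → j < st.k → dg st.deg j = 3 := by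
    rintro v hv j rfl hj
    rw [← all_deg h hp j hj, hv]
  calc _ ≤ ∑ i ∈ (Finset.range st.k).filter (fun i => F.degree (f i) = 3),
        (2 - ((F.neighborFinset (f i)).filter (fun u => F.degree u = 3)).card) := by
        rw [Finset.sum_filter]
        apply Finset.sum_le_sum
        intro i hi
        rw [Finset.mem_range] at hi
        cases hb : (Nat.beq (dg st.deg i) 3 && mem' i st.sd)
        · simp
        · simp only [Bool.and_eq_true, Nat.beq_eq, mem'_iff] at hb
          have h3 : F.degree (f i) = 3 := by rw [all_deg h hp i hi, hb.1]
          have := h.nbS_sd hdeg i hb.2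
          rw [if_pos h3]
          simp only [cond_true, len_eq]
          exact Nat.sub_le_sub_left this 2
    _ = ∑ v ∈ ((Finset.range st.k).filter (fun i => F.degree (f i) = 3)).image f,
        (2 - ((F.neighborFinset v).filter (fun u => F.degree u = 3)).card) := by
        rw [Finset.sum_image]
        intro i hi j hj hij
        simp only [Finset.coe_filter, Finset.mem_range, Set.mem_ofPred_eq] at hi hj
        exact h.inj i hi.1 j hj.1 hij
    _ ≤ _ := by
        apply Finset.sum_le_sum_of_subset
        intro u hu
        simp only [Finset.mem_image, Finset.mem_filter, Finset.mem_range] at hu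
        obtain ⟨i, hi, rfl⟩ := hu
        simpa using hi.2

theorem adj_update {u : V} {i : ℕ} (hi : i < st.k) (ha : F.Adj (f i) u) :
    F.Adj (Function.update f st.k u i) (Function.update f st.k u st.k) := by
  rw [Function.update_self, Function.update_of_ne hi.ne]
  exact ha

theorem prune_sound {P : Par} (ctx : Ctx P F) (h : Sat F st f) {i : ℕ}
    (hc : prune P st i = true) : False := by
  unfold prune at hc
  simp only [Bool.and_eq_true, Bool.or_eq_true, blt_iff, Nat.ble_eq, len_eq] at hc
  obtain ⟨h1, ⟨h2, h3⟩ | ⟨h2, h3⟩⟩ := hc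
  · have := (h.deg i (by omega)).2
    have := h.nb_len i
    omega
  · have := ctx.two h2 (f i)
    have := h.nbS i
    omega

theorem check_sound {P : Par} (ctx : Ctx P F) (n : ℕ) : ∀ (st : St) (s s' : List ℕ),
    check P n st s = some s' → ∀ f : ℕ → V, Sat F st f → False := by
  induction n with
  | zero => intro st s s' hc; simp [check] at hc
  | succ n ih =>
    intro st s s' hc f h
    match s with
    | [] => simp [check] at hc
    | t :: s =>
    unfold check at hc
    cases h0 : Nat.beq t 0
    case true =>
      simp only [h0, cond_true] at hc
      match s with
      | [] => simp at hc
      | m :: s =>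
      obtain ⟨M, s1, hc⟩ := takeE_some _ _ _ _ _ hc
      match s1 with
      | [] => simp at hc
      | m1 :: s1 =>
      obtain ⟨o, s2, hc⟩ := takeE_some _ _ _ _ _ hc
      cases hb : (isM st M [] && refute st o [] M)
      · simp [hb] at hc
      · rw [Bool.and_eq_true] at hb
        exact kill_sound ctx.good h M o hb.1 hb.2
    case false =>
    cases h3 : Nat.beq t 3
    case true =>
      simp only [h0, h3, cond_true, cond_false] at hc
      cases hb : (P.lem && Nat.blt (cntLt (fun i => Nat.beq (dg st.deg i) 3) st.k) (P.n 3) &&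
          allLt (fun i => Nat.blt 0 (dg st.deg i)) st.k)
      · simp [hb] at hc
      · simp only [hb, cond_true] at hc
        simp only [Bool.and_eq_true, blt_iff] at hb
        obtain ⟨u, hu, hu'⟩ := fresh_three h hb.2 (by
          rw [ctx.cnt hb.1.1]
          exact hb.1.2)
        exact ih _ _ _ hc _ (h.addS hu' hu)
    case false =>
    cases h7 : Nat.beq t 7
    case true =>
      simp only [h0, h3, h7, cond_true, cond_false] at hc
      cases hb : (P.lem && Nat.blt P.slack (deficit st) &&
          allLt (fun i => Nat.blt 0 (dg st.deg i)) st.k)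
      · simp [hb] at hc
      · simp only [Bool.and_eq_true, blt_iff] at hb
        have := deficit_sound h hb.2
        have := ctx.slack hb.1.1
        omega
    case false =>
    simp only [h0, h3, h7, cond_false] at hc
    match s with
    | [] => simp at hc
    | i :: s =>
    simp only [force_eq] at hc
    cases h1 : Nat.beq t 1
    case true =>
      simp only [h1, cond_true] at hc
      match s with
      | [] => simp at hc
      | j :: s =>
      simp only at hc
      cases hb : (Nat.blt i st.k && Nat.blt j st.k)
      · simp [hb] at hc
      · simp only [hb, cond_true] at hc
        simp only [Bool.and_eq_true, blt_iff] at hb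
        cases hc1 : check P n (addYes st i j) s with
        | none => simp [hc1] at hc
        | some s1 =>
          simp only [hc1] at hc
          by_cases ha : F.Adj (f i) (f j)
          · exact ih _ _ _ hc1 _ (h.addYes hb.1 hb.2 ha)
          · exact ih _ _ _ hc _ (h.addNo hb.1 hb.2 ha)
    case false =>
    cases h2 : Nat.beq t 2
    case true =>
      simp only [h1, h2, cond_true, cond_false] at hc
      cases hb : (P.lem && canFreshS st i)
      · simp [hb] at hc
      · simp only [hb, cond_true] at hc
        simp only [Bool.and_eq_true] at hb
        obtain ⟨hi, hcase⟩ := h.canFreshS hb.2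
        cases hc1 : check P n (addYes (addS st) i st.k) s with
        | none => simp [hc1] at hc
        | some s1 =>
          simp only [hc1] at hc
          rcases hcase with ⟨u, hu, hd, hf⟩ | hs
          · exact ih _ _ _ hc1 _ ((h.addS hf hd).addYes (Nat.lt_succ_of_lt hi)
              (Nat.lt_succ_self _) (adj_update hi hu))
          · exact ih _ _ _ hc _ hs
    case false =>
    cases h4 : Nat.beq t 4
    case true =>
      simp only [h1, h2, h4, cond_true, cond_false] at hc
      cases hb : (P.lem && canFresh st i)
      · simp [hb] at hc
      · simp only [hb, cond_true] at hc
        simp only [Bool.and_eq_true] at hb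
        obtain ⟨hi, u, hu, hf⟩ := h.canFresh hb.2
        have hB : ∀ d, F.degree u = d → Sat F (RSR.addYes (RSR.addB st d) i st.k)
            (Function.update f st.k u) := fun d hd =>
          (h.addB hf d (fun _ => hd)).addYes (Nat.lt_succ_of_lt hi)
              (Nat.lt_succ_self _) (adj_update hi hu)
        generalize hq : (bif mem' i st.sd then some s else
          check P n (addYes (addS st) i st.k) s) = q at hc
        match q, hq with
        | none, hq => simp at hc
        | some s1, hq =>
          simp only at hc
          cases hc2 : check P n (addYes (addB st 4) i st.k) s1 with
          | none => simp [hc2] at hc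
          | some s2 =>
            simp only [hc2] at hc
            rcases ctx.degs hb.1 u with hd | hd | hd
            · cases hm : mem' i st.sd
              · simp only [hm, cond_false] at hq
                exact ih _ _ _ hq _ ((h.addS hf hd).addYes (Nat.lt_succ_of_lt hi)
                  (Nat.lt_succ_self _) (adj_update hi hu))
              · rw [mem'_iff] at hm
                obtain ⟨j, hj, hj'⟩ := (h.sd i hm).2 u hu hd
                exact hf j (h.nb_yes hj).1 hj'
            · exact ih _ _ _ hc2 _ (hB 4 hd)
            · exact ih _ _ _ hc _ (hB 5 hd)
    case false =>
    cases h5 : Nat.beq t 5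
    case true =>
      simp only [h1, h2, h4, h5, cond_true, cond_false] at hc
      cases hb : prune P st i
      · simp [hb] at hc
      · exact prune_sound ctx h hb
    case false =>
    cases h6 : Nat.beq t 6
    case true =>
      simp only [h1, h2, h4, h5, h6, cond_true, cond_false] at hc
      cases hb : (P.lem && Nat.blt (P.n i) (cntLt (fun j => Nat.beq (dg st.deg j) i) st.k) &&
            Nat.blt 0 i)
      · simp [hb] at hc
      · simp only [Bool.and_eq_true, blt_iff] at hb
        have := cnt_sound h i hb.2
        rw [ctx.cnt hb.1.1] at this
        omega
    case false =>
    cases h8 : Nat.beq t 8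
    case true =>
      simp only [h1, h2, h4, h5, h6, h8, cond_true, cond_false] at hc
      cases hb : (!P.lem && canFresh st i)
      · simp [hb] at hc
      · simp only [hb, cond_true] at hc
        simp only [Bool.and_eq_true] at hb
        obtain ⟨hi, u, hu, hf⟩ := h.canFresh hb.2
        exact ih _ _ _ hc _ ((h.addB hf 0 (fun h => absurd rfl h)).addYes (Nat.lt_succ_of_lt hi)
              (Nat.lt_succ_self _) (adj_update hi hu))
    case false =>
      simp [h1, h2, h4, h5, h6, h8] at hc


/-! ### From the arrowing property to the structural hypotheses -/

theorem good_of_arrows (hcard : Fintype.card V = 11)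
    (hA : Arrows F (pathGraph 3) (cycleGraph 11)) : Good F := by
  intro M hM hadj
  let R : SimpleGraph V :=
    { Adj := fun u v => (u, v) ∈ M ∨ (v, u) ∈ M
      symm := ⟨fun u v h => h.symm⟩
      loopless := ⟨fun u h => F.loopless.irrefl u (by
        rcases h with h | h <;> exact hadj _ h)⟩ }
  have hR : ∀ u v, R.Adj u v ↔ (u, v) ∈ M ∨ (v, u) ∈ M := fun u v => Iff.rfl
  have hRF : R ≤ F := by
    intro u v h
    rcases h with h | h
    · exact hadj _ h
    · exact (hadj _ h).symm
  have hdis : ∀ p ∈ M, ∀ q ∈ M, p ≠ q →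
      (p.1 ≠ q.1 ∧ p.1 ≠ q.2 ∧ p.2 ≠ q.1 ∧ p.2 ≠ q.2) := by
    intro p hp q hq hpq
    rw [List.pairwise_iff_getElem] at hM
    obtain ⟨i, hi, rfl⟩ := List.getElem_of_mem hp
    obtain ⟨j, hj, rfl⟩ := List.getElem_of_mem hq
    rcases lt_trichotomy i j with hij | rfl | hij
    · exact hM i j hi hj hij
    · exact absurd rfl hpq
    · have := hM j i hj hi hij
      exact ⟨this.1.symm, this.2.2.1.symm, this.2.1.symm, this.2.2.2.symm⟩
  rcases hA R hRF with ⟨φ, hφ⟩ | ⟨g, hg⟩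
  · exfalso
    have h01 : R.Adj (φ 0) (φ 1) := φ.map_rel (by rw [pathGraph_adj]; decide)
    have h12 : R.Adj (φ 1) (φ 2) := φ.map_rel (by rw [pathGraph_adj]; decide)
    have n01 : φ 0 ≠ φ 1 := h01.ne
    have n12 : φ 1 ≠ φ 2 := h12.ne
    have n02 : φ 0 ≠ φ 2 := fun h => absurd (hφ h) (by decide)
    rw [hR] at h01 h12
    rcases h01 with h01 | h01 <;> rcases h12 with h12 | h12
    · have := hdis _ h01 _ h12 (by simp [n01])
      exact this.2.2.1 rfl
    · have := hdis _ h01 _ h12 (by simp [n02])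
      exact this.2.2.2 rfl
    · have := hdis _ h01 _ h12 (by simp [n02])
      exact this.1 rfl
    · have := hdis _ h01 _ h12 (by simp [n12])
      exact this.2.1 rfl
  · have hsurj : Function.Surjective g := by
      have : Function.Bijective g := by
        rw [Fintype.bijective_iff_injective_and_card]
        exact ⟨hg, by simp [hcard]⟩
      exact this.2
    let H : SimpleGraph V :=
      { Adj := fun u v => ∃ i j, (cycleGraph 11).Adj i j ∧ g i = u ∧ g j = v
        symm := ⟨fun u v ⟨i, j, h, h1, h2⟩ => ⟨j, i, h.symm, h2, h1⟩⟩
        loopless := ⟨fun u ⟨i, j, h, h1, h2⟩ => h.ne (hg (h1.trans h2.symm))⟩ }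
    have hadjH : ∀ u v, H.Adj u v ↔
        ∃ i j, (cycleGraph 11).Adj i j ∧ g i = u ∧ g j = v := fun u v => Iff.rfl
    refine ⟨H, ?_, ?_, ?_, ?_⟩
    · intro u v h
      rw [hadjH] at h
      obtain ⟨i, j, hij, rfl, rfl⟩ := h
      exact (g.map_rel hij).1
    · intro p hp h
      rw [hadjH] at h
      obtain ⟨i, j, hij, h1, h2⟩ := h
      have h3 : ¬ R.Adj (g i) (g j) := (g.map_rel hij).2
      rw [h1, h2] at h3
      exact h3 (Or.inl hp)
    · intro v
      obtain ⟨i, rfl⟩ := hsurj v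
      refine ⟨g (i + 1), g (i - 1), ?_, ?_⟩
      · intro h
        have h1 := hg h
        clear h
        revert h1
        revert i
        decide
      · intro u
        rw [hadjH]
        constructor
        · rintro ⟨i', j, hij, h1, rfl⟩
          have := hg h1
          subst this
          have hor : j = i' + 1 ∨ j = i' - 1 := by
            rw [cycleGraph_adj] at hij
            rcases hij with h | h
            · right; rw [← h]; abel
            · left; rw [← h]; abel
          rcases hor with rfl | rfl
          · exact Or.inl rfl
          · exact Or.inr rfl
        · rintro (rfl | rfl)
          · refine ⟨i, i + 1, ?_, rfl, rfl⟩
            rw [cycleGraph_adj]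
            right; abel
          · refine ⟨i, i - 1, ?_, rfl, rfl⟩
            rw [cycleGraph_adj]
            left; abel
    · intro X hX hcl
      obtain ⟨v, hv⟩ := hX
      obtain ⟨i, rfl⟩ := hsurj v
      have key : ∀ n : ℕ, g ((fun j => j + 1)^[n] i) ∈ X := by
        intro n
        induction n with
        | zero => simpa using hv
        | succ n ih =>
          rw [Function.iterate_succ_apply']
          apply hcl _ ih
          rw [hadjH]
          refine ⟨_, _, ?_, rfl, rfl⟩
          rw [cycleGraph_adj]
          right
          abel
      have hit : ∀ i j : Fin 11, (fun j => j + 1)^[(j - i).val] i = j := by decide +kernel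
      have : X = Finset.univ := by
        rw [Finset.eq_univ_iff_forall]
        intro w
        obtain ⟨j, rfl⟩ := hsurj w
        have := key (j - i).val
        rwa [hit] at this
      rw [this, Finset.card_univ, hcard]

theorem beq_ne {a b : ℕ} (h : a ≠ b) : Nat.beq a b = false := by
  cases hb : Nat.beq a b
  · rfl
  · exact absurd (Nat.eq_of_beq_eq_true hb) h

theorem min_degree (hG : Good F) (v : V) : 3 ≤ F.degree v := by
  by_contra hlt
  obtain ⟨H, hH, -, h1⟩ := hG [] (by simp) (by simp)
  obtain ⟨a, b, hab, h2⟩ := h1.two v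
  have ha : F.Adj v a := hH ((h2 a).2 (Or.inl rfl))
  obtain ⟨H', hH', h3, h4⟩ := hG [(v, a)] (by simp) (by simpa using ha)
  have h5 := h4.two_le v ((F.neighborFinset v).erase a) (by
    intro x hx
    rw [Finset.mem_erase, SimpleGraph.mem_neighborFinset]
    refine ⟨?_, hH' hx⟩
    rintro rfl
    exact h3 (v, x) (by simp) hx)
  rw [Finset.card_erase_of_mem (by rwa [SimpleGraph.mem_neighborFinset])] at h5
  change 2 ≤ F.degree v - 1 at h5
  omega

theorem lemma_one (hG : Good F) (v : V) :
    ((F.neighborFinset v).filter (fun u => F.degree u = 3)).card ≤ 2 := by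
  by_contra hlt
  push Not at hlt
  rw [Finset.two_lt_card_iff] at hlt
  obtain ⟨a, b, c, ha, hb, hc, hab, hac, hbc⟩ := hlt
  rw [Finset.mem_filter, SimpleGraph.mem_neighborFinset] at ha hb hc
  have ctx : Ctx parL F :=
    ⟨hG, fun h => absurd h (by decide), fun h => absurd h (by decide),
      fun h => absurd h (by decide), fun h => absurd h (by decide)⟩
  have hs := checkL
  rw [Option.isSome_iff_exists] at hs
  obtain ⟨s', hs⟩ := hs
  let f : ℕ → V := fun i => if i = 0 then v else if i = 1 then a else if i = 2 then b else c
  refine check_sound ctx 200 stL _ s' hs f ⟨?_, ?_, ?_, ?_, ?_⟩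
  · have va := ha.1.ne
    have vb := hb.1.ne
    have vc := hc.1.ne
    intro i hi j hj hij
    change i < 4 at hi
    change j < 4 at hj
    interval_cases i <;> interval_cases j <;> simp_all [f]
  · intro i hi
    have : i = 1 ∨ i = 2 ∨ i = 3 := by
      by_contra hcon
      push Not at hcon
      apply hi
      change dg [(1, 3), (2, 3), (3, 3)] i = 0
      simp [dg, beq_ne hcon.1.symm, beq_ne hcon.2.1.symm, beq_ne hcon.2.2.symm]
    rcases this with rfl | rfl | rfl
    · exact ⟨by decide, ha.2⟩
    · exact ⟨by decide, hb.2⟩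
    · exact ⟨by decide, hc.2⟩
  · intro p hp
    simp only [stL, List.mem_cons, List.not_mem_nil, or_false] at hp
    rcases hp with rfl | rfl | rfl
    · exact ⟨by decide, by decide, ha.1⟩
    · exact ⟨by decide, by decide, hb.1⟩
    · exact ⟨by decide, by decide, hc.1⟩
  · intro p hp
    simp [stL] at hp
  · intro p hp
    simp [stL] at hp

theorem sat_one (v : V) (hv : F.degree v = 3) : Sat F st1 (fun _ => v) := by
  refine ⟨?_, ?_, ?_, ?_, ?_⟩
  · intro i hi j hj hij
    change i < 1 at hi
    change j < 1 at hj
    omega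
  · intro i hi
    change (bif Nat.beq 0 i then 3 else 0) ≠ 0 at hi
    change i < 1 ∧ F.degree v = (bif Nat.beq 0 i then 3 else 0)
    cases hb : Nat.beq 0 i
    · simp [hb] at hi
    · have := Nat.eq_of_beq_eq_true hb
      subst this
      exact ⟨by decide, hv⟩
  · intro p hp
    simp [st1] at hp
  · intro p hp
    simp [st1] at hp
  · intro p hp
    simp [st1] at hp

theorem no_ctx {P : Par} (hP : (check P 200 st1 (digs cert6)).isSome = true ∨
    (check P 200 st1 (digs cert7)).isSome = true) (ctx : Ctx P F) (v : V)
    (hv : F.degree v = 3) : False := by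
  rcases hP with hs | hs
  · rw [Option.isSome_iff_exists] at hs
    obtain ⟨s', hs⟩ := hs
    exact check_sound ctx 200 st1 _ s' hs _ (sat_one v hv)
  · rw [Option.isSome_iff_exists] at hs
    obtain ⟨s', hs⟩ := hs
    exact check_sound ctx 200 st1 _ s' hs _ (sat_one v hv)

theorem double_count :
    ∑ v, ((F.neighborFinset v).filter (fun u => F.degree u = 3)).card =
      3 * (Finset.univ.filter (fun v => F.degree v = 3)).card := by
  have := Finset.sum_card_bipartiteAbove_eq_sum_card_bipartiteBelow
    (s := (Finset.univ : Finset V)) (t := Finset.univ.filter (fun v => F.degree v = 3)) F.Adj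
  calc _ = ∑ v, (Finset.bipartiteAbove F.Adj
        (Finset.univ.filter (fun v => F.degree v = 3)) v).card := by
        apply Finset.sum_congr rfl
        intro v _
        congr 1
        ext u
        simp [Finset.mem_bipartiteAbove, and_comm]
    _ = _ := this
    _ = ∑ v ∈ Finset.univ.filter (fun v => F.degree v = 3), 3 := by
        apply Finset.sum_congr rfl
        intro v hv
        rw [Finset.mem_filter] at hv
        rw [← hv.2]
        change _ = (F.neighborFinset v).card
        congr 1
        ext u
        simp [Finset.mem_bipartiteBelow, SimpleGraph.adj_comm]
    _ = _ := by rw [Finset.sum_const, smul_eq_mul, mul_comm]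

theorem lower (hcard : Fintype.card V = 11) (hG : Good F) (e : ℕ)
    (hdeg : ∑ v, F.degree v = 2 * e) (he : e < 20) : False := by
  have hmin := min_degree hG
  have htwo := lemma_one hG
  have hdc := double_count (F := F)
  set n3 := (Finset.univ.filter (fun v => F.degree v = 3)).card with hn3
  set S := Finset.univ.filter (fun v => F.degree v = 3) with hS
  set B := Finset.univ.filter (fun v => ¬ F.degree v = 3) with hB
  have hSB : S.card + B.card = 11 := by
    rw [← hcard, ← Finset.card_univ]
    exact Finset.card_filter_add_card_filter_not _
  rw [← Finset.sum_filter_add_sum_filter_not Finset.univ (fun v => F.degree v = 3)] at hdc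
  rw [← hS, ← hB] at hdc
  have hBle : ∑ v ∈ B, ((F.neighborFinset v).filter (fun u => F.degree u = 3)).card ≤
      B.card * 2 := Finset.sum_le_card_nsmul _ _ _ (fun v _ => htwo v)
  have hSle : ∑ v ∈ S, ((F.neighborFinset v).filter (fun u => F.degree u = 3)).card ≤
      S.card * 2 := Finset.sum_le_card_nsmul _ _ _ (fun v _ => htwo v)
  have hslack : ∑ v ∈ S, (2 - ((F.neighborFinset v).filter (fun u => F.degree u = 3)).card) +
      ∑ v ∈ S, ((F.neighborFinset v).filter (fun u => F.degree u = 3)).card = S.card * 2 := by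
    rw [← Finset.sum_add_distrib, ← smul_eq_mul, ← Finset.sum_const]
    apply Finset.sum_congr rfl
    intro v _
    have := htwo v
    omega
  have hex : ∑ v, (F.degree v - 3) + 33 = 2 * e := by
    rw [← hdeg]
    have : (33 : ℕ) = ∑ v : V, 3 := by simp [hcard]
    rw [this, ← Finset.sum_add_distrib]
    apply Finset.sum_congr rfl
    intro v _
    have := hmin v
    omega
  have hexB : ∑ v ∈ B, (F.degree v - 3) ≤ ∑ v, (F.degree v - 3) :=
    Finset.sum_le_sum_of_subset (Finset.subset_univ _)
  have hone : ∀ T ⊆ B, T.card ≤ ∑ v ∈ T, (F.degree v - 3) := by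
    intro T hT
    rw [Finset.card_eq_sum_ones]
    apply Finset.sum_le_sum
    intro v hv
    have h1 := hT hv
    rw [hB, Finset.mem_filter] at h1
    have := hmin v
    omega
  have hdegs : ∀ v, F.degree v = 3 ∨ F.degree v = 4 ∨ F.degree v = 5 := by
    intro v
    by_contra hcon
    have hm := hmin v
    have hvB : v ∈ B := by
      rw [hB, Finset.mem_filter]
      exact ⟨Finset.mem_univ _, by omega⟩
    have h1 := hone (B.erase v) (Finset.erase_subset _ _)
    rw [Finset.card_erase_of_mem hvB] at h1
    have h2 := Finset.add_sum_erase B (fun v => F.degree v - 3) hvB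
    omega
  have hn : ∀ d, (Finset.univ.filter (fun v => F.degree v = d)).card =
      ∑ v, if F.degree v = d then 1 else 0 := fun d => Finset.card_filter _ _
  have hcnt : n3 + (Finset.univ.filter (fun v => F.degree v = 4)).card +
      (Finset.univ.filter (fun v => F.degree v = 5)).card = 11 := by
    rw [hn3, hn, hn, hn, ← Finset.sum_add_distrib, ← Finset.sum_add_distrib, ← hcard,
      ← Finset.card_univ, Finset.card_eq_sum_ones]
    apply Finset.sum_congr rfl
    intro v _
    rcases hdegs v with h | h | h <;> simp [h]
  have hsum : 3 * n3 + 4 * (Finset.univ.filter (fun v => F.degree v = 4)).card +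
      5 * (Finset.univ.filter (fun v => F.degree v = 5)).card = 2 * e := by
    rw [← hdeg, hn3, hn, hn, hn, Finset.mul_sum, Finset.mul_sum, Finset.mul_sum,
      ← Finset.sum_add_distrib, ← Finset.sum_add_distrib]
    apply Finset.sum_congr rfl
    intro v _
    rcases hdegs v with h | h | h <;> simp [h]
  have hzero : ∀ d, d ≠ 3 → d ≠ 4 → d ≠ 5 →
      (Finset.univ.filter (fun v => F.degree v = d)).card = 0 := by
    intro d h3 h4 h5
    rw [Finset.card_eq_zero, Finset.filter_eq_empty_iff]
    intro v _ hv
    have := hdegs v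
    omega
  have hSn : S.card = n3 := rfl
  obtain ⟨v, hv⟩ : S.Nonempty := by
    rw [← Finset.card_pos]
    omega
  have hv3 : F.degree v = 3 := (Finset.mem_filter.1 hv).2
  have hcase : (n3 = 6 ∧ (Finset.univ.filter (fun v => F.degree v = 4)).card = 5 ∧
      (Finset.univ.filter (fun v => F.degree v = 5)).card = 0) ∨
      (n3 = 7 ∧ (Finset.univ.filter (fun v => F.degree v = 4)).card = 3 ∧
      (Finset.univ.filter (fun v => F.degree v = 5)).card = 1) := by
    omega
  rcases hcase with ⟨h3, h4, h5⟩ | ⟨h3, h4, h5⟩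
  · refine no_ctx (P := par6) (Or.inl check6) ⟨hG, fun _ => hdegs, fun _ d => ?_,
      fun _ => htwo, fun _ => ?_⟩ v hv3
    · by_cases d3 : d = 3
      · subst d3; exact h3
      by_cases d4 : d = 4
      · subst d4; exact h4
      by_cases d5 : d = 5
      · subst d5; exact h5
      rw [hzero d d3 d4 d5]
      simp [par6, beq_ne d3, beq_ne d4]
    · change _ ≤ 4
      rw [← hS]
      omega
  · refine no_ctx (P := par7) (Or.inr check7) ⟨hG, fun _ => hdegs, fun _ d => ?_,
      fun _ => htwo, fun _ => ?_⟩ v hv3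
    · by_cases d3 : d = 3
      · subst d3; exact h3
      by_cases d4 : d = 4
      · subst d4; exact h4
      by_cases d5 : d = 5
      · subst d5; exact h5
      rw [hzero d d3 d4 d5]
      simp [par7, beq_ne d3, beq_ne d4, beq_ne d5]
    · change _ ≤ 1
      rw [← hS]
      omega

end

theorem lower_bound (V : Type) [Fintype V] (F : SimpleGraph V) (hcard : Fintype.card V = 11)
    (he : F.edgeSet.ncard < 20) : ¬ Arrows F (pathGraph 3) (cycleGraph 11) := by
  classical
  intro hA
  have hG := good_of_arrows hcard hA
  refine lower hcard hG F.edgeFinset.card F.sum_degrees_eq_twice_card_edges ?_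
  rwa [← SimpleGraph.coe_edgeFinset, Set.ncard_coe_finset] at he

/-! ### The upper bound -/

def upE : List (ℕ × ℕ) :=
  [(0, 5), (0, 6), (0, 9), (1, 2), (1, 3), (1, 6), (1, 8), (2, 4), (2, 9), (2, 10), (3, 4), (3, 10), (4, 8), (5, 7), (5, 8), (5, 10), (6, 7), (6, 10), (7, 9), (8, 9)]

def upC : List (List ℕ) :=
  [[0, 5, 8, 4, 2, 10, 3, 1, 6, 7, 9],
   [0, 5, 7, 9, 8, 1, 2, 4, 3, 10, 6],
   [0, 6, 7, 5, 10, 2, 1, 3, 4, 8, 9],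
   [0, 6, 7, 5, 10, 3, 1, 8, 4, 2, 9],
   [0, 5, 10, 2, 4, 3, 1, 8, 9, 7, 6],
   [0, 5, 7, 6, 10, 3, 4, 8, 1, 2, 9],
   [0, 5, 7, 9, 8, 4, 2, 1, 3, 10, 6],
   [0, 5, 10, 3, 4, 8, 1, 2, 9, 7, 6],
   [0, 6, 10, 2, 4, 3, 1, 8, 5, 7, 9],
   [0, 5, 7, 6, 10, 2, 4, 3, 1, 8, 9],
   [0, 6, 7, 5, 10, 3, 4, 2, 1, 8, 9],
   [0, 5, 7, 9, 8, 4, 3, 1, 2, 10, 6],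
   [0, 5, 8, 4, 3, 1, 2, 10, 6, 7, 9],
   [0, 5, 8, 1, 2, 4, 3, 10, 6, 7, 9],
   [0, 6, 1, 2, 10, 3, 4, 8, 5, 7, 9],
   [0, 5, 7, 6, 10, 3, 1, 2, 4, 8, 9],
   [0, 5, 10, 3, 1, 2, 4, 8, 9, 7, 6],
   [0, 6, 10, 3, 1, 2, 4, 8, 5, 7, 9],
   [0, 5, 7, 9, 8, 4, 2, 10, 3, 1, 6],
   [0, 5, 10, 3, 4, 2, 1, 8, 9, 7, 6],
   [0, 6, 10, 2, 1, 3, 4, 8, 5, 7, 9],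
   [0, 5, 8, 1, 3, 4, 2, 10, 6, 7, 9],
   [0, 5, 8, 4, 2, 1, 3, 10, 6, 7, 9],
   [0, 5, 10, 2, 1, 3, 4, 8, 9, 7, 6],
   [0, 5, 7, 9, 8, 1, 3, 4, 2, 10, 6],
   [0, 5, 7, 6, 10, 2, 1, 3, 4, 8, 9],
   [0, 6, 10, 3, 4, 2, 1, 8, 5, 7, 9],
   [0, 6, 7, 5, 10, 2, 4, 3, 1, 8, 9],
   [0, 6, 7, 5, 10, 3, 1, 2, 4, 8, 9],
   [0, 5, 7, 6, 10, 3, 4, 2, 1, 8, 9],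
   [0, 5, 7, 9, 8, 4, 3, 10, 2, 1, 6],
   [0, 5, 7, 6, 1, 3, 10, 2, 4, 8, 9],
   [0, 6, 1, 3, 10, 2, 4, 8, 5, 7, 9],
   [0, 6, 7, 5, 10, 3, 4, 8, 1, 2, 9],
   [0, 5, 8, 4, 3, 10, 2, 1, 6, 7, 9],
   [0, 5, 10, 3, 1, 8, 4, 2, 9, 7, 6]]

/-- Is `{a, b}` a pair of consecutive vertices of the list? -/
def adjc (a b : ℕ) : List ℕ → Bool
  | [] => false
  | x :: l =>
    match l with
    | [] => false
    | y :: _ => (Nat.beq x a && Nat.beq y b) || (Nat.beq x b && Nat.beq y a) || adjc a b l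

/-- The closed walk of a cycle. -/
def close (c : List ℕ) : List ℕ := c ++ c.take 1

/-- Every matching inside `es` avoiding the vertices `used` misses one of the cycles. -/
def go : List (ℕ × ℕ) → List ℕ → List (List ℕ) → Bool
  | [], _, cs => !cs.isEmpty
  | (a, b) :: es, used, cs =>
    go es used cs && (mem' a used || mem' b used ||
      go es (a :: b :: used) (cs.filter (fun c => !adjc a b c)))

theorem go_sound (P : ℕ × ℕ → Prop) (es : List (ℕ × ℕ)) : ∀ (used : List ℕ) (cs : List (List ℕ)),
    go es used cs = true →
    es.Pairwise (fun p q => P p → P q → p.1 ≠ q.1 ∧ p.1 ≠ q.2 ∧ p.2 ≠ q.1 ∧ p.2 ≠ q.2) →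
    (∀ p ∈ es, P p → p.1 ∉ used ∧ p.2 ∉ used) →
    ∃ c ∈ cs, ∀ p ∈ es, P p → adjc p.1 p.2 c = false := by
  induction es with
  | nil =>
    intro used cs hg _ _
    match cs with
    | [] => simp [go] at hg
    | c :: cs => exact ⟨c, by simp, by simp⟩
  | cons p es ih =>
    obtain ⟨a, b⟩ := p
    intro used cs hg hp hu
    simp only [go, Bool.and_eq_true, Bool.or_eq_true, mem'_iff] at hg
    rw [List.pairwise_cons] at hp
    by_cases hP : P (a, b)
    · have h1 := hu (a, b) (by simp) hP
      rcases hg.2 with (h | h) | h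
      · exact absurd h h1.1
      · exact absurd h h1.2
      · obtain ⟨c, hc, hc'⟩ := ih _ _ h hp.2 (by
          intro q hq hPq
          have h2 := hp.1 q hq hP hPq
          have h3 := hu q (by simp [hq]) hPq
          simp only [List.mem_cons, not_or]
          exact ⟨⟨h2.1.symm, h2.2.2.1.symm, h3.1⟩, ⟨h2.2.1.symm, h2.2.2.2.symm, h3.2⟩⟩)
        rw [List.mem_filter] at hc
        refine ⟨c, hc.1, fun q hq hPq => ?_⟩
        rcases List.mem_cons.1 hq with rfl | hq
        · simpa using hc.2
        · exact hc' q hq hPq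
    · obtain ⟨c, hc, hc'⟩ := ih _ _ hg.1 hp.2 (fun q hq => hu q (by simp [hq]))
      refine ⟨c, hc, fun q hq hPq => ?_⟩
      rcases List.mem_cons.1 hq with rfl | hq
      · exact absurd hPq hP
      · exact hc' q hq hPq

theorem go_up : go upE [] (upC.map close) = true := by decide +kernel

/-- The extremal graph. -/
def upF : SimpleGraph (Fin 11) where
  Adj u v := (u.val, v.val) ∈ upE ∨ (v.val, u.val) ∈ upE
  symm := ⟨fun _ _ h => h.symm⟩
  loopless := ⟨by decide +kernel⟩

instance : DecidableRel upF.Adj := fun u v =>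
  inferInstanceAs (Decidable ((u.val, v.val) ∈ upE ∨ (v.val, u.val) ∈ upE))

theorem up_card : upF.edgeSet.ncard = 20 := by
  rw [← SimpleGraph.coe_edgeFinset, Set.ncard_coe_finset]
  decide +kernel

/-- The function given by a list of vertices. -/
def fn (c : List ℕ) (i : Fin 11) : Fin 11 := Fin.ofNat 11 (c.getD i.val 0)

theorem up_inj : ∀ c ∈ upC, ∀ i j : Fin 11, fn (close c) i = fn (close c) j → i = j := by
  decide +kernel

theorem up_edge : ∀ c ∈ upC, ∀ i : Fin 11, ∃ p ∈ upE, adjc p.1 p.2 (close c) = true ∧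
    ((p.1 = (fn (close c) i).val ∧ p.2 = (fn (close c) (i + 1)).val) ∨
      (p.2 = (fn (close c) i).val ∧ p.1 = (fn (close c) (i + 1)).val)) := by
  decide +kernel

theorem up_lt : ∀ p ∈ upE, p.1 < 11 ∧ p.2 < 11 := by decide +kernel

theorem up_pw : upE.Pairwise (fun p q => p ≠ q ∧ (p.1, p.2) ≠ (q.2, q.1)) := by decide +kernel

theorem up_arrows : Arrows upF (pathGraph 3) (cycleGraph 11) := by
  intro R hR
  by_cases hP3 : ∃ x y z, R.Adj x y ∧ R.Adj y z ∧ x ≠ z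
  · left
    obtain ⟨x, y, z, hxy, hyz, hxz⟩ := hP3
    refine ⟨⟨![x, y, z], ?_⟩, ?_⟩
    · intro i j hij
      rw [pathGraph_adj] at hij
      fin_cases i <;> fin_cases j <;> simp at hij <;> simp [hxy, hyz, hxy.symm, hyz.symm]
    · intro i j hij
      have h1 := hxy.ne
      have h2 := hyz.ne
      fin_cases i <;> fin_cases j <;> simp_all
  · right
    have hm : ∀ x y z, R.Adj x y → R.Adj y z → x = z := by
      intro x y z h1 h2
      by_contra h3
      exact hP3 ⟨x, y, z, h1, h2, h3⟩
    let P : ℕ × ℕ → Prop := fun p => R.Adj (Fin.ofNat 11 p.1) (Fin.ofNat 11 p.2)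
    obtain ⟨c', hc', hcR⟩ := go_sound P upE [] _ go_up (by
      have hall : upE.Pairwise (fun p q => (p ≠ q ∧ (p.1, p.2) ≠ (q.2, q.1)) ∧
          p.1 < 11 ∧ p.2 < 11 ∧ q.1 < 11 ∧ q.2 < 11) := by decide +kernel
      refine hall.imp ?_
      rintro ⟨a, b⟩ ⟨a', b'⟩ ⟨⟨h1, h2⟩, l1, l2, l3, l4⟩ hp hq
      have hv : ∀ m n : ℕ, m < 11 → n < 11 → Fin.ofNat 11 m = Fin.ofNat 11 n → m = n := by
        intro m n hm hn h
        have := congrArg Fin.val h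
        simpa [Fin.val_ofNat, Nat.mod_eq_of_lt hm, Nat.mod_eq_of_lt hn] using this
      simp only [P] at hp hq l1 l2 l3 l4 ⊢
      refine ⟨?_, ?_, ?_, ?_⟩
      · rintro rfl
        have := hv _ _ l2 l4 (hm _ _ _ hp.symm hq)
        exact h1 (by rw [this])
      · rintro rfl
        have := hv _ _ l2 l3 (hm _ _ _ hp.symm hq.symm)
        exact h2 (by simp [this])
      · rintro rfl
        have := hv _ _ l1 l4 (hm _ _ _ hp hq)
        exact h2 (by simp [this])
      · rintro rfl
        have := hv _ _ l1 l3 (hm _ _ _ hp hq.symm)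
        exact h1 (by rw [this])) (by simp)
    rw [List.mem_map] at hc'
    obtain ⟨c, hc, rfl⟩ := hc'
    have key : ∀ i, (upF \ R).Adj (fn (close c) i) (fn (close c) (i + 1)) := by
      intro i
      obtain ⟨p, hp, h1, h2⟩ := up_edge c hc i
      have h3 : ¬ P p := by
        intro hP
        rw [hcR p hp hP] at h1
        exact Bool.noConfusion h1
      have hval : ∀ w : Fin 11, Fin.ofNat 11 w.val = w := fun w => by simp
      rcases h2 with ⟨h4, h5⟩ | ⟨h4, h5⟩
      · refine ⟨Or.inl ?_, fun hr => h3 ?_⟩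
        · rw [← h4, ← h5]; exact hp
        · change R.Adj (Fin.ofNat 11 p.1) (Fin.ofNat 11 p.2)
          rw [h4, h5, hval, hval]; exact hr
      · refine ⟨Or.inr ?_, fun hr => h3 ?_⟩
        · rw [← h4, ← h5]; exact hp
        · change R.Adj (Fin.ofNat 11 p.1) (Fin.ofNat 11 p.2)
          rw [h4, h5, hval, hval]; exact hr.symm
    refine ⟨⟨fn (close c), ?_⟩, fun i j h => up_inj c hc i j h⟩
    intro i j hij
    rw [cycleGraph_adj] at hij
    rcases hij with h | h
    · have : i = j + 1 := by rw [← h]; abel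
      rw [this]
      exact (key j).symm
    · have : j = i + 1 := by rw [← h]; abel
      rw [this]
      exact key i

end RSR

theorem stmt_11 :
    (∃ F : SimpleGraph (Fin 11), F.edgeSet.ncard = 20 ∧
      Arrows F (pathGraph 3) (cycleGraph 11)) ∧
    (∀ (V : Type) [Fintype V] (F : SimpleGraph V), Fintype.card V = 11 →
      F.edgeSet.ncard < 20 → ¬ Arrows F (pathGraph 3) (cycleGraph 11)) := by
  refine ⟨⟨RSR.upF, RSR.up_card, RSR.up_arrows⟩, ?_⟩
  intro V _ F hcard he
  exact RSR.lower_bound V F hcard he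
end

section
/- For every integer n ≥ 4, the Ramsey number r(P_3, C_n) equals n: the complete graph K_n satisfies K_n → (P_3, C_n), and K_{n−1} does not arrow (P_3, C_n). -/
open SimpleGraph

lemma matching_cycle (m : ℕ) : ∀ R : SimpleGraph (Fin (m + 4)),
    (∀ a b c, R.Adj a b → R.Adj a c → b = c) →
    ∃ f : Fin (m + 4) → Fin (m + 4), Function.Injective f ∧
      ∀ i, ¬ R.Adj (f i) (f (i + 1)) := by
  induction m with
  | zero =>
    intro R hR
    have h0 : ∀ a b c, b ≠ c → R.Adj a b → ¬ R.Adj a c := fun a b c hbc h h' => hbc (hR a b c h h')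
    have hs : ∀ a b, R.Adj a b → R.Adj b a := fun a b h => h.symm
    by_cases h1 : R.Adj 0 1 ∨ R.Adj 2 3
    · refine ⟨![0, 2, 1, 3], by decide, ?_⟩
      have e1 := h0 0 1 2 (by decide)
      have e2 := h0 0 1 3 (by decide)
      have e3 := h0 1 0 2 (by decide)
      have e4 := h0 1 0 3 (by decide)
      have e5 := h0 2 3 0 (by decide)
      have e6 := h0 2 3 1 (by decide)
      have e7 := h0 3 2 0 (by decide)
      have e8 := h0 3 2 1 (by decide)
      intro i
      fin_cases i <;> simp <;> grind
    · by_cases h2 : R.Adj 0 2 ∨ R.Adj 1 3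
      · refine ⟨![0, 1, 2, 3], by decide, ?_⟩
        have e1 := h0 0 2 1 (by decide)
        have e2 := h0 0 2 3 (by decide)
        have e3 := h0 2 0 1 (by decide)
        have e4 := h0 2 0 3 (by decide)
        have e5 := h0 1 3 0 (by decide)
        have e6 := h0 1 3 2 (by decide)
        have e7 := h0 3 1 0 (by decide)
        have e8 := h0 3 1 2 (by decide)
        intro i
        fin_cases i <;> simp <;> grind
      · refine ⟨![0, 1, 3, 2], by decide, ?_⟩
        intro i
        fin_cases i <;> simp <;> grind
  | succ m ih =>
    intro R hR
    obtain ⟨f, hf, hc⟩ := ih (R.comap Fin.castSucc) (fun a b c hab hac =>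
      Fin.castSucc_injective _ (hR _ _ _ hab hac))
    have hj : ∃ j, ∀ k, k ≠ j → ¬ R.Adj (Fin.last (m + 4)) (f k).castSucc := by
      by_cases h : ∃ j, R.Adj (Fin.last (m + 4)) (f j).castSucc
      · obtain ⟨j, hj⟩ := h
        exact ⟨j, fun k hk h' => hk (hf (Fin.castSucc_injective _ (hR _ _ _ h' hj)))⟩
      · push Not at h
        exact ⟨0, fun k _ => h k⟩
    obtain ⟨j, hj⟩ := hj
    have one_ne : (1 : Fin (m + 4)) ≠ 0 := by simp
    have two_ne : (1 + 1 : Fin (m + 4)) ≠ 0 := by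
      intro h
      have := congrArg Fin.val h
      rw [Fin.val_add, Fin.val_one, Fin.val_zero, Nat.mod_eq_of_lt (by omega)] at this
      omega
    refine ⟨Fin.snoc (α := fun _ => Fin (m + 5)) (fun i => (f (i + (j + (1 + 1)))).castSucc)
      (Fin.last (m + 4)), ?_, ?_⟩
    · rw [Fin.snoc_injective_iff]
      refine ⟨fun a b hab => ?_, ?_⟩
      · exact add_right_cancel (hf (Fin.castSucc_injective _ hab))
      · rintro ⟨i, hi⟩
        exact (Fin.castSucc_lt_last _).ne hi
    · intro i
      induction i using Fin.lastCases with
      | last =>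
        have e : Fin.last (m + 4) + 1 = (0 : Fin (m + 4)).castSucc := by simp
        rw [e, Fin.snoc_last, Fin.snoc_castSucc]
        apply hj
        rw [zero_add]
        exact fun h => two_ne (add_eq_left.mp h)
      | cast i =>
        induction i using Fin.lastCases with
        | last =>
          have e : (Fin.last (m + 3)).castSucc + 1 = Fin.last (m + 4) := by
            rw [Fin.coeSucc_eq_succ]; rfl
          rw [e, Fin.snoc_last, Fin.snoc_castSucc]
          intro h
          refine hj _ ?_ h.symm
          have e2 : Fin.last (m + 3) + (j + (1 + 1)) = j + 1 := by
            have : Fin.last (m + 3) + 1 = 0 := by simp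
            calc Fin.last (m + 3) + (j + (1 + 1)) = (Fin.last (m + 3) + 1) + (j + 1) := by abel
              _ = j + 1 := by rw [this, zero_add]
          rw [e2]
          exact fun h => one_ne (add_eq_left.mp h)
        | cast i =>
          have e : i.castSucc.castSucc + 1 = (i.castSucc + 1).castSucc := by
            rw [Fin.coeSucc_eq_succ, Fin.coeSucc_eq_succ]; rfl
          rw [e, Fin.snoc_castSucc, Fin.snoc_castSucc]
          have := hc (i.castSucc + (j + (1 + 1)))
          rw [show i.castSucc + (j + (1 + 1)) + 1 = i.castSucc + 1 + (j + (1 + 1)) by abel] at this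
          exact this

theorem stmt_17 (n : ℕ) (hn : 4 ≤ n) :
    Arrows (⊤ : SimpleGraph (Fin n)) (pathGraph 3) (cycleGraph n) ∧
    ¬ Arrows (⊤ : SimpleGraph (Fin (n - 1))) (pathGraph 3) (cycleGraph n) := by
  constructor
  · intro R _
    by_cases hR : ∀ a b c, R.Adj a b → R.Adj a c → b = c
    · right
      obtain ⟨m, rfl⟩ := Nat.exists_eq_add_of_le' hn
      obtain ⟨f, hf, hc⟩ := matching_cycle m R hR
      refine ⟨⟨f, ?_⟩, hf⟩
      intro a b hab
      have hne := hab.ne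
      rw [cycleGraph_adj] at hab
      rw [SimpleGraph.sdiff_adj, SimpleGraph.top_adj]
      refine ⟨fun h => hne (hf h), ?_⟩
      rcases hab with h | h
      · obtain rfl : a = b + 1 := by rw [← h]; abel
        exact fun h => hc _ h.symm
      · obtain rfl : b = a + 1 := by rw [← h]; abel
        exact hc _
    · left
      push Not at hR
      obtain ⟨a, b, c, hab, hac, hbc⟩ := hR
      have h1 := hab.ne
      have h2 := hac.ne
      have h3 := hab.symm
      have h4 := hac.symm
      refine ⟨⟨![b, a, c], ?_⟩, ?_⟩
      · intro i j hij
        rw [pathGraph_adj] at hij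
        fin_cases i <;> fin_cases j <;> simp_all
      · intro i j hij
        fin_cases i <;> fin_cases j <;> simp_all [eq_comm]
  · intro h
    rcases h ⊥ bot_le with ⟨f, hf⟩ | ⟨f, hf⟩
    · have : (pathGraph 3).Adj 0 1 := by rw [pathGraph_adj]; simp
      exact f.map_rel this
    · have := Fintype.card_le_of_injective f hf
      simp at this
      omega
end

section
/- The Turán number ex(7, C_4) equals 9: every simple graph on 7 vertices containing no subgraph isomorphic to the cycle C_4 has at most 9 edges, and there exists a simple graph on 7 vertices with 9 edges containing no subgraph isomorphic to C_4. -/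
open SimpleGraph

/-- No 4-cycle, spelled out on vertices. -/
theorem no_four_cycle {V : Type} (F : SimpleGraph V) (h : ¬ Contains F (cycleGraph 4))
    (a b c d : V) (hac : a ≠ c) (hbd : b ≠ d) (hab : F.Adj a b) (hbc : F.Adj b c)
    (hcd : F.Adj c d) (hda : F.Adj d a) : False := by
  apply h
  refine ⟨⟨![a, b, c, d], ?_⟩, ?_⟩
  · intro i j hij
    have hij' : (cycleGraph 4).Adj i j := hij
    revert hij'
    fin_cases i <;> fin_cases j <;>
      first
      | (intro _; simp [hab, hbc, hcd, hda, hab.symm, hbc.symm, hcd.symm, hda.symm]; done)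
      | (intro h'; exact absurd h' (by decide))
  · have h1 := hab.ne
    have h2 := hbc.ne
    have h3 := hcd.ne
    have h4 := hda.ne
    intro i j hij
    have hij' : (![a, b, c, d] : Fin 4 → V) i = ![a, b, c, d] j := hij
    revert hij'
    fin_cases i <;> fin_cases j <;> simp <;> grind

theorem upper_bound (V : Type) [Fintype V] (F : SimpleGraph V) (hV : Fintype.card V = 7)
    (hF : ¬ Contains F (cycleGraph 4)) : F.edgeSet.ncard ≤ 9 := by
  classical
  have h4 := no_four_cycle F hF
  have hncard : F.edgeSet.ncard = F.edgeFinset.card := by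
    rw [← coe_edgeFinset, Set.ncard_coe_finset]
  have hsum := F.sum_degrees_eq_twice_card_edges
  rw [hncard]
  -- codegrees
  let co : V → V → ℕ := fun u v => (F.neighborFinset u ∩ F.neighborFinset v).card
  have hco : ∀ u v, u ≠ v → co u v ≤ 1 := by
    intro u v huv
    refine Finset.card_le_one.2 ?_
    intro x hx y hy
    simp only [Finset.mem_inter, mem_neighborFinset] at hx hy
    by_contra hxy
    exact h4 u x v y huv hxy hx.1 hx.2.symm hy.2 hy.1.symm
  have hdc : ∀ v, ∑ w ∈ F.neighborFinset v, F.degree w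
      = F.degree v + ∑ u ∈ Finset.univ.erase v, co u v := by
    intro v
    have h1 : ∑ w ∈ F.neighborFinset v, F.degree w = ∑ u, co u v := by
      have := Finset.sum_card_bipartiteAbove_eq_sum_card_bipartiteBelow
        (s := F.neighborFinset v) (t := (Finset.univ : Finset V)) (fun a b => F.Adj a b)
      convert this using 2 with w hw u hu
      · rw [← card_neighborFinset_eq_degree]
        congr 1
        ext x; simp [Finset.bipartiteAbove]
      · change Finset.card _ = Finset.card _
        congr 1
        ext x; simp [Finset.bipartiteBelow, adj_comm, and_comm]
    rw [h1, ← Finset.add_sum_erase _ _ (Finset.mem_univ v)]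
    simp [co]
  have herase : ∀ v : V, (Finset.univ.erase v).card = 6 := by
    intro v; simp [hV]
  by_contra hcon
  by_cases hbig : ∃ v, 4 ≤ F.degree v
  · obtain ⟨v, hv⟩ := hbig
    have hA : ∑ w ∈ F.neighborFinset v, F.degree w ≤ F.degree v + 6 := by
      rw [hdc v]
      have := Finset.sum_le_card_nsmul (Finset.univ.erase v) (fun u => co u v) 1
        (fun u hu => hco u v (Finset.ne_of_mem_erase hu))
      rw [herase] at this
      simpa using this
    let B := Finset.univ.erase v \ F.neighborFinset v
    have hsub : F.neighborFinset v ⊆ Finset.univ.erase v := by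
      intro x hx
      have := (mem_neighborFinset _ _ _).1 hx
      simp [this.ne']
    have hBc : B.card = 6 - F.degree v := by
      rw [Finset.card_sdiff_of_subset hsub, herase, card_neighborFinset_eq_degree]
    have hB : ∀ u ∈ B, F.degree u ≤ 6 - F.degree v := by
      intro u hu
      have hu' : u ≠ v ∧ ¬ F.Adj v u := by simpa [B] using hu
      have hs : F.neighborFinset u ⊆ (F.neighborFinset u ∩ F.neighborFinset v) ∪ B.erase u := by
        intro x hx
        have hx' := (mem_neighborFinset _ _ _).1 hx
        by_cases hvx : F.Adj v x
        · simp [hx', hvx]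
        · have : x ≠ v := by rintro rfl; exact hu'.2 hx'.symm
          simp [B, hvx, this, hx'.ne']
      have h1 := (Finset.card_le_card hs).trans (Finset.card_union_le _ _)
      have h2 := hco u v hu'.1
      have h3 := Finset.card_erase_add_one hu
      rw [card_neighborFinset_eq_degree] at h1
      simp only [co] at h2
      omega
    have hBs := Finset.sum_le_card_nsmul B (fun u => F.degree u) _ hB
    have htot : ∑ u, F.degree u = F.degree v +
        (∑ u ∈ B, F.degree u + ∑ w ∈ F.neighborFinset v, F.degree w) := by
      rw [← Finset.add_sum_erase _ _ (Finset.mem_univ v), Finset.sum_sdiff hsub]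
    have hd6 : F.degree v ≤ 6 := by
      have := Finset.card_le_card hsub
      rwa [herase, card_neighborFinset_eq_degree] at this
    rw [hBc] at hBs
    generalize ∑ u ∈ B, F.degree u = S at *
    generalize F.degree v = d at *
    interval_cases d <;> simp at hBs hA htot <;> omega
  · have h3 : ∀ v, F.degree v ≤ 3 := by
      intro v
      by_contra hv
      exact hbig ⟨v, by omega⟩
    have hlow : ∀ v, F.degree v = 3 → ∃ w, F.Adj v w ∧ F.degree w < 3 := by
      intro v hv
      by_contra hno
      push Not at hno
      have hs : ∑ w ∈ F.neighborFinset v, F.degree w = 9 := by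
        rw [Finset.sum_congr rfl (g := fun _ => 3)]
        · simp [hv]
        · intro w hw
          have := hno w ((mem_neighborFinset _ _ _).1 hw)
          have := h3 w
          omega
      rw [hdc v, hv] at hs
      have hone : ∀ u ∈ Finset.univ.erase v, co u v = 1 := by
        refine (Finset.sum_eq_sum_iff_of_le
          (fun u hu => hco u v (Finset.ne_of_mem_erase hu))).1 ?_
        simp only [Finset.sum_const, herase]
        simp; omega
      rw [← card_neighborFinset_eq_degree, Finset.card_eq_three] at hv
      obtain ⟨a, b, c, hab, hac, hbc, hN⟩ := hv
      have hmem : ∀ x, F.Adj v x ↔ x = a ∨ x = b ∨ x = c := by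
        intro x
        rw [← mem_neighborFinset, hN]; simp
      have hm : ∀ x, F.Adj v x → ∃ y, F.Adj x y ∧ F.Adj v y := by
        intro x hx
        have h1 := hone x (by simp [hx.ne'])
        obtain ⟨y, hy⟩ := Finset.card_pos.1 (by rw [show (F.neighborFinset x ∩ F.neighborFinset v).card = 1 from h1]; exact one_pos)
        exact ⟨y, by simpa using hy⟩
      have hva := (hmem a).2 (by simp)
      have hvb := (hmem b).2 (by simp)
      have hvc := (hmem c).2 (by simp)
      have path : ∀ x y z, F.Adj v x → F.Adj v y → F.Adj v z → x ≠ z →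
          F.Adj x y → F.Adj y z → False := by
        intro x y z hx hy hz hxz h1 h2
        exact h4 v x y z hy.ne hxz hx h1 h2 hz.symm
      have ea : F.Adj a b ∨ F.Adj a c := by
        obtain ⟨y, hy, hy'⟩ := hm a hva
        rcases (hmem y).1 hy' with rfl | rfl | rfl
        · exact absurd rfl hy.ne
        · exact Or.inl hy
        · exact Or.inr hy
      have eb : F.Adj b a ∨ F.Adj b c := by
        obtain ⟨y, hy, hy'⟩ := hm b hvb
        rcases (hmem y).1 hy' with rfl | rfl | rfl
        · exact Or.inl hy
        · exact absurd rfl hy.ne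
        · exact Or.inr hy
      have ec : F.Adj c a ∨ F.Adj c b := by
        obtain ⟨y, hy, hy'⟩ := hm c hvc
        rcases (hmem y).1 hy' with rfl | rfl | rfl
        · exact Or.inl hy
        · exact Or.inr hy
        · exact absurd rfl hy.ne
      rcases ea with e1 | e1
      · rcases ec with e2 | e2
        · exact path c a b hvc hva hvb hbc.symm e2 e1
        · exact path a b c hva hvb hvc hac e1 e2.symm
      · rcases eb with e2 | e2
        · exact path b a c hvb hva hvc hbc e2 e1
        · exact path a c b hva hvc hvb hab e1 e2.symm
    -- total deficiency is at most one
    have hdef : ∑ v, (3 - F.degree v) ≤ 1 := by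
      have : ∑ v, (3 - F.degree v) + ∑ v, F.degree v = 21 := by
        rw [← Finset.sum_add_distrib, Finset.sum_congr rfl (g := fun _ => 3)]
        · simp [hV]
        · intro v _
          have := h3 v
          omega
      omega
    have huniq : ∀ u w, F.degree u < 3 → F.degree w < 3 → u = w := by
      intro u w hu hw
      by_contra huw
      have := Finset.sum_le_sum_of_subset (f := fun v => 3 - F.degree v)
        (Finset.subset_univ ({u, w} : Finset V))
      rw [Finset.sum_pair huw] at this
      omega
    have hex : ∃ w, F.degree w < 3 := by
      obtain ⟨v⟩ : Nonempty V := Fintype.card_pos_iff.1 (by omega)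
      by_cases hv : F.degree v < 3
      · exact ⟨v, hv⟩
      · obtain ⟨w, -, hw⟩ := hlow v (by have := h3 v; omega)
        exact ⟨w, hw⟩
    obtain ⟨w, hw⟩ := hex
    have hs : Finset.univ.erase w ⊆ F.neighborFinset w := by
      intro x hx
      have hx' := Finset.ne_of_mem_erase hx
      have hx3 : F.degree x = 3 := by
        by_contra hne
        exact hx' (huniq x w (by have := h3 x; omega) hw)
      obtain ⟨y, hy, hy'⟩ := hlow x hx3
      rw [mem_neighborFinset, ← huniq y w hy' hw]
      exact hy.symm
    have := Finset.card_le_card hs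
    rw [herase, card_neighborFinset_eq_degree] at this
    omega

/-- Adjacency (as a Boolean) of three triangles sharing the vertex `0`. -/
def friendAdj (i j : Fin 7) : Bool :=
  i != j && (i == 0 || j == 0 || (i.val + 1) / 2 == (j.val + 1) / 2)

/-- The friendship graph on seven vertices. -/
def friendGraph : SimpleGraph (Fin 7) where
  Adj i j := friendAdj i j = true
  symm := ⟨by decide⟩
  loopless := ⟨by decide⟩

instance : DecidableRel friendGraph.Adj := fun i j =>
  inferInstanceAs (Decidable (friendAdj i j = true))

theorem friend_no_cycle : ∀ a c : Fin 7, a ≠ c → ∀ b : Fin 7, friendAdj a b = true →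
    friendAdj b c = true → ∀ d : Fin 7, b ≠ d → friendAdj c d = true →
    friendAdj d a = true → False := by
  decide

theorem lower_bound :
    ∃ F : SimpleGraph (Fin 7), ¬ Contains F (cycleGraph 4) ∧ F.edgeSet.ncard = 9 := by
  refine ⟨friendGraph, ?_, ?_⟩
  · rintro ⟨f, hf⟩
    have h01 : friendGraph.Adj (f 0) (f 1) := f.map_rel (by decide)
    have h12 : friendGraph.Adj (f 1) (f 2) := f.map_rel (by decide)
    have h23 : friendGraph.Adj (f 2) (f 3) := f.map_rel (by decide)
    have h30 : friendGraph.Adj (f 3) (f 0) := f.map_rel (by decide)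
    exact friend_no_cycle (f 0) (f 2) (hf.ne (by decide)) (f 1) h01 h12 (f 3)
      (hf.ne (by decide)) h23 h30
  · have h := friendGraph.sum_degrees_eq_twice_card_edges
    have h' : ∑ v, friendGraph.degree v = 18 := by decide
    rw [← coe_edgeFinset, Set.ncard_coe_finset]
    omega

theorem stmt_19 :
    (∀ (V : Type) [Fintype V] (F : SimpleGraph V), Fintype.card V = 7 →
      ¬ Contains F (cycleGraph 4) → F.edgeSet.ncard ≤ 9) ∧
    (∃ F : SimpleGraph (Fin 7), ¬ Contains F (cycleGraph 4) ∧ F.edgeSet.ncard = 9) :=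
  ⟨fun V _ F hV hF => upper_bound V F hV hF, lower_bound⟩
end
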